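/- arXiv:1103.2459 — 2 statements merged into one kernel-verified Lean document; each statement's English description precedes it below -/
import Mathlib

section
/- Let K be a field of characteristic zero, S = K[x_1, …, x_ℓ], and let f = α_1 ⋯ α_n be a product of pairwise non-proportional nonzero linear forms (a central hyperplane arrangement). If pd_S Ω^1(f) ≤ 1 and every associated prime of S/J_f has height exactly 2, then D(f) is a free S-module. -/
open CategoryTheory MvPolynomial

/-- The `n`-th Ext group of the `R`-modules `M` and `N`. -/
noncomputable def ExtGrp (R : Type) [CommRing R] (M N : ModuleCat R) (n : ℕ) : ModuleCat R :=
  ((Ext R (ModuleCat R) n).obj (Opposite.op M)).obj N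

/-- `pdLE R M n` means that the projective dimension of `M` over `R` is at most `n`,
expressed via the vanishing of `Ext^{n+1}(M, -)`. -/
def pdLE (R : Type) [CommRing R] (M : ModuleCat R) (n : ℕ) : Prop :=
  ∀ N : ModuleCat R, Subsingleton (ExtGrp R M N (n + 1))

/-- The module of logarithmic derivations
`D(f) = {θ ∈ S^ℓ : Σ_i θ_i ∂f/∂x_i ∈ (f)}`. -/
noncomputable def Dlog (K : Type) [CommRing K] (ℓ : ℕ) (f : MvPolynomial (Fin ℓ) K) :
    Submodule (MvPolynomial (Fin ℓ) K) (Fin ℓ → MvPolynomial (Fin ℓ) K) :=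
  Submodule.comap
    (∑ i : Fin ℓ, (LinearMap.toSpanSingleton (MvPolynomial (Fin ℓ) K)
      (MvPolynomial (Fin ℓ) K) (pderiv i f)).comp (LinearMap.proj i))
    (Ideal.span {f})

/-- The Jacobian ideal `J_f = (∂f/∂x_1, …, ∂f/∂x_ℓ)`. -/
noncomputable def jacobianIdeal (K : Type) [CommRing K] (ℓ : ℕ)
    (f : MvPolynomial (Fin ℓ) K) : Ideal (MvPolynomial (Fin ℓ) K) :=
  Ideal.span (Set.range fun i => pderiv i f)

theorem aux_ext_lift (R : Type) [CommRing R] (M : ModuleCat R) (h : pdLE R M 1)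
    (P : ProjectiveResolution M) (N : ModuleCat R) (u : P.complex.X 2 ⟶ N)
    (hu : P.complex.d 3 2 ≫ u = 0) : ∃ v : P.complex.X 1 ⟶ N, P.complex.d 2 1 ≫ v = u := by
  have h1 : Limits.IsZero (ExtGrp R M N 2) := by
    have := h N
    exact ModuleCat.isZero_of_subsingleton _
  have h2 : Limits.IsZero ((P.complex.linearYonedaObj R N).homology 2) :=
    Limits.IsZero.of_iso h1 (P.isoExt 2 N).symm
  rw [← HomologicalComplex.exactAt_iff_isZero_homology,
    HomologicalComplex.exactAt_iff' _ 1 2 3 (by simp) (by simp)] at h2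
  rw [ShortComplex.moduleCat_exact_iff] at h2
  obtain ⟨v, hv⟩ := h2 u hu
  exact ⟨v, hv⟩

theorem aux_split {R P Q : Type} [CommRing R] [AddCommGroup P] [Module R P] [AddCommGroup Q]
    [Module R Q] [Module.Projective R P] (d : P →ₗ[R] Q) (v : P →ₗ[R] P)
    (hv : ∀ x, d x = 0 → v x = x) (hd : ∀ x, d (v x) = 0) :
    Module.Projective R (LinearMap.range d) := by
  let i0 : (P ⧸ LinearMap.ker d) →ₗ[R] P := (LinearMap.ker d).liftQ (LinearMap.id - v) (by
    intro x hx
    simp [hv x hx])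
  refine Module.Projective.of_split (P := LinearMap.range d) (M := P)
    (i0 ∘ₗ d.quotKerEquivRange.symm.toLinearMap) d.rangeRestrict ?_
  ext ⟨_, x, rfl⟩
  have : d.quotKerEquivRange.symm ⟨d x, x, rfl⟩ = Submodule.Quotient.mk x := by
    rw [LinearEquiv.symm_apply_eq]; rfl
  simp only [LinearMap.comp_apply, LinearEquiv.coe_coe, this]
  simp [i0, hd]

theorem proj_of_pdLE (R : Type) [CommRing R] (M : ModuleCat R) (h : pdLE R M 1)
    (F : Type) [AddCommGroup F] [Module R F] [Module.Projective R F] (π : F →ₗ[R] M)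
    (hπ : Function.Surjective π) : Module.Projective R (LinearMap.ker π) := by
  let P := projectiveResolution M
  let d21 := (P.complex.d 2 1).hom
  let d10 := (P.complex.d 1 0).hom
  let p : P.complex.X 0 →ₗ[R] M := (P.π.f 0).hom
  obtain ⟨v, hv⟩ := aux_ext_lift R M h P (ModuleCat.of R (LinearMap.range d21))
    (ModuleCat.ofHom d21.rangeRestrict) (by
      ext x
      have := P.complex.d_comp_d 3 2 1
      exact congr($(this).hom x))
  have hP1 : Module.Projective R (P.complex.X 1) :=
    (IsProjective.iff_projective _).mpr (P.projective 1)
  have hP0 : Module.Projective R (P.complex.X 0) :=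
    (IsProjective.iff_projective _).mpr (P.projective 0)
  have hex1 : ∀ x, d10 x = 0 → ∃ y, d21 y = x := by
    have := P.exact_succ 0
    rw [ShortComplex.moduleCat_exact_iff] at this
    exact this
  have h10 : ∀ y, d10 (d21 y) = 0 := by
    intro y
    have := P.complex.d_comp_d 2 1 0
    exact congr($(this).hom y)
  have hex0 : ∀ x, p x = 0 → ∃ y, d10 y = x := by
    have := P.exact₀
    rw [ShortComplex.moduleCat_exact_iff] at this
    exact this
  have hp0 : ∀ y, p (d10 y) = 0 := by
    intro y
    have := P.complex_d_comp_π_f_zero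
    exact congr($(this).hom y)
  have hps : Function.Surjective p := by
    have : Epi (P.π.f 0) := inferInstance
    exact (ModuleCat.epi_iff_surjective _).mp this
  have hB : Module.Projective R (LinearMap.range d10) := by
    apply aux_split d10 ((LinearMap.range d21).subtype ∘ₗ v.hom)
    · intro x hx
      obtain ⟨y, rfl⟩ := hex1 x hx
      have := congr(($(hv).hom y : LinearMap.range d21))
      exact congr_arg Subtype.val this
    · intro x
      obtain ⟨y, hy⟩ := (v.hom x).2
      simp only [LinearMap.comp_apply, Submodule.subtype_apply]
      rw [← hy, h10]
  obtain ⟨s, hs⟩ := Module.projective_lifting_property p π hps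
  obtain ⟨r, hr⟩ := Module.projective_lifting_property π p hπ
  have hs' : ∀ x, p (s x) = π x := fun x => congr($hs x)
  have hr' : ∀ x, π (r x) = p x := fun x => congr($hr x)
  let i : LinearMap.ker π →ₗ[R] (LinearMap.range d10 × F) :=
    LinearMap.prod (LinearMap.codRestrict _ (s ∘ₗ (LinearMap.ker π).subtype) (by
      rintro ⟨x, hx⟩
      obtain ⟨y, hy⟩ := hex0 (s x) (by rw [hs']; exact hx)
      exact ⟨y, hy⟩)) (LinearMap.ker π).subtype
  let q : (LinearMap.range d10 × F) →ₗ[R] LinearMap.ker π :=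
    LinearMap.codRestrict _ (r ∘ₗ (LinearMap.range d10).subtype ∘ₗ LinearMap.fst R _ _ +
      (LinearMap.id - r ∘ₗ s) ∘ₗ LinearMap.snd R _ _) (by
      rintro ⟨⟨_, y, rfl⟩, x⟩
      simp [hr', hs', hp0])
  refine Module.Projective.of_split i q ?_
  ext ⟨x, hx⟩
  simp [i, q]

theorem aux_comp_mul {K σ : Type} [Field K] (a v : MvPolynomial σ K) (e d : ℕ)
    (hv : v.IsHomogeneous e) :
    homogeneousComponent d (a * v) = (if e ≤ d then homogeneousComponent (d - e) a else 0) * v := by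
  conv_lhs => rw [← sum_homogeneousComponent a, Finset.sum_mul, map_sum]
  have : ∀ k, homogeneousComponent d (homogeneousComponent k a * v) =
      if k + e = d then homogeneousComponent k a * v else 0 := by
    intro k
    exact homogeneousComponent_of_mem
      ((mem_homogeneousSubmodule _ _).mpr ((homogeneousComponent_isHomogeneous k a).mul hv)) |>.trans
      (by simp [eq_comm])
  simp_rw [this]
  split_ifs with h
  · have h2 : ∀ k, (k + e = d) ↔ k = d - e := by intro k; omega
    simp_rw [h2]
    rw [Finset.sum_ite_eq']
    split_ifs with h3
    · rfl
    · rw [homogeneousComponent_eq_zero]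
      · simp
      · simp at h3; omega
  · rw [zero_mul]
    apply Finset.sum_eq_zero
    intro k _
    rw [if_neg (by omega)]

theorem free_of_graded_projective {K : Type} [Field K] {ℓ : ℕ}
    (D : Submodule (MvPolynomial (Fin ℓ) K) (Fin ℓ → MvPolynomial (Fin ℓ) K))
    (hD : ∀ θ ∈ D, ∀ d : ℕ, (fun i => homogeneousComponent d (θ i)) ∈ D)
    [Module.Projective (MvPolynomial (Fin ℓ) K) D] :
    Module.Free (MvPolynomial (Fin ℓ) K) D := by
  classical
  let S := MvPolynomial (Fin ℓ) K
  let H : Set (Fin ℓ → S) := {θ | θ ∈ D ∧ ∃ d, ∀ i, (θ i).IsHomogeneous d}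
  have hspan : Submodule.span S H = D := by
    apply le_antisymm
    · rw [Submodule.span_le]; intro x hx; exact hx.1
    · intro θ hθ
      let N := Finset.univ.sup fun i => (θ i).totalDegree
      have : θ = ∑ d ∈ Finset.range (N + 1), (fun i => homogeneousComponent d (θ i)) := by
        funext i
        rw [Finset.sum_apply]
        conv_lhs => rw [← sum_homogeneousComponent (θ i)]
        apply Finset.sum_subset
        · apply Finset.range_mono
          have : (θ i).totalDegree ≤ N := Finset.le_sup (f := fun i => (θ i).totalDegree) (Finset.mem_univ i)
          omega
        · intro k _ hk
          apply homogeneousComponent_eq_zero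
          simp at hk; omega
      rw [this]
      refine Submodule.sum_mem _ fun d _ => Submodule.subset_span ⟨hD θ hθ d, d, fun i => ?_⟩
      exact homogeneousComponent_isHomogeneous _ _
  have hex : ∃ r, ∃ T : Finset (Fin ℓ → S), (T : Set _) ⊆ H ∧ Submodule.span S (T : Set _) = D ∧ T.card = r := by
    have hfg : (Submodule.span S H).FG := IsNoetherian.noetherian _
    rw [Submodule.fg_span_iff_fg_span_finset_subset] at hfg
    obtain ⟨T, hT, h2⟩ := hfg
    exact ⟨_, T, hT, by rw [← h2, hspan], rfl⟩
  obtain ⟨T, hTH, hTs, hTc⟩ := Nat.find_spec hex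
  have hmin : ∀ T' : Finset (Fin ℓ → S), (T' : Set _) ⊆ H → Submodule.span S (T' : Set _) = D →
      T.card ≤ T'.card := by
    intro T' h1 h2
    rw [hTc]
    exact Nat.find_min' hex ⟨T', h1, h2, rfl⟩
  have hrel : ∀ a : T → S, (∑ t, a t • (t : Fin ℓ → S) = 0) → ∀ t, constantCoeff (a t) = 0 := by
    intro a ha t
    by_contra hc
    obtain ⟨-, e, he⟩ := hTH t.2
    have h1 : ∀ u : T, ∃ b : S, (fun i => homogeneousComponent e (a u * (u : Fin ℓ → S) i)) =
        b • (u : Fin ℓ → S) := by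
      intro u
      obtain ⟨-, e', he'⟩ := hTH u.2
      refine ⟨(if e' ≤ e then homogeneousComponent (e - e') (a u) else 0), ?_⟩
      funext i
      rw [aux_comp_mul _ _ e' e (he' i)]; rfl
    have h2 : (fun i => homogeneousComponent e (a t * (t : Fin ℓ → S) i)) =
        (C (constantCoeff (a t)) : S) • (t : Fin ℓ → S) := by
      funext i
      rw [aux_comp_mul _ _ e e (he i)]
      simp [constantCoeff_eq]
    have h3 : ∑ u : T, (fun i => homogeneousComponent e (a u * (u : Fin ℓ → S) i)) = 0 := by
      funext i
      have := congr(homogeneousComponent e ($ha i))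
      simpa using this
    rw [← Finset.add_sum_erase _ _ (Finset.mem_univ t), h2] at h3
    have hmem : (C (constantCoeff (a t)) : S) • (t : Fin ℓ → S) ∈
        Submodule.span S ((T.erase t : Finset _) : Set (Fin ℓ → S)) := by
      rw [eq_neg_of_add_eq_zero_left h3]
      refine Submodule.neg_mem _ (Submodule.sum_mem _ fun u hu => ?_)
      obtain ⟨b, hb⟩ := h1 u
      rw [hb]
      refine Submodule.smul_mem _ _ (Submodule.subset_span ?_)
      simp only [Finset.coe_erase, Set.mem_sdiff]
      refine ⟨u.2, fun h => (Finset.ne_of_mem_erase hu) (Subtype.ext h)⟩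
    have hmem' : (t : Fin ℓ → S) ∈ Submodule.span S ((T.erase t : Finset _) : Set (Fin ℓ → S)) := by
      have := Submodule.smul_mem _ (C (constantCoeff (a t))⁻¹ : S) hmem
      rwa [smul_smul, ← C_mul, inv_mul_cancel₀ hc, C_1, one_smul] at this
    have := hmin (T.erase t) ((Finset.coe_subset.mpr (Finset.erase_subset _ _)).trans hTH) (by
      apply le_antisymm
      · rw [← hTs]
        exact Submodule.span_mono (Finset.coe_subset.mpr (Finset.erase_subset _ _))
      · conv_lhs => rw [← hTs]
        rw [Submodule.span_le]
        intro x hx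
        by_cases hxt : x = t
        · rw [hxt]; exact hmem'
        · exact Submodule.subset_span (by simp [hxt]; exact hx))
    rw [Finset.card_erase_of_mem t.2] at this
    have := Finset.card_pos.mpr ⟨_, t.2⟩
    omega
  have hTD : ∀ t : T, (t : Fin ℓ → S) ∈ D := fun t => (hTH t.2).1
  let L : (T → S) →ₗ[S] D := Fintype.linearCombination S (fun t : T => (⟨t, hTD t⟩ : D))
  have hL : ∀ a, ((L a : D) : Fin ℓ → S) = ∑ t, a t • (t : Fin ℓ → S) := by
    intro a
    simp [L, Fintype.linearCombination_apply]
  have hLs : Function.Surjective L := by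
    rintro ⟨θ, hθ⟩
    rw [← hTs] at hθ
    rw [← Subtype.range_coe (s := (T : Set (Fin ℓ → S))), Submodule.mem_span_range_iff_exists_fun] at hθ
    obtain ⟨c, hc⟩ := hθ
    exact ⟨c, Subtype.ext ((hL c).trans hc)⟩
  obtain ⟨s, hs⟩ := Module.projective_lifting_property L LinearMap.id hLs
  have hs' : ∀ x, L (s x) = x := fun x => congr($hs x)
  have hker : LinearMap.ker L ≤ RingHom.ker (constantCoeff (σ := Fin ℓ) (R := K)) • LinearMap.ker L := by
    intro x hx
    have h0 : ∑ t, x t • (t : Fin ℓ → S) = 0 := by rw [← hL, hx]; rfl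
    have h1 : x = ∑ t, x t • (Pi.single t 1 - s (L (Pi.single t 1))) := by
      have h2 : ∑ t, x t • (Pi.single t (1 : S) : T → S) = x := by
        simpa [← Pi.single_smul] using (Finset.univ_sum_single x)
      simp only [smul_sub, Finset.sum_sub_distrib, h2]
      simp only [← map_smul, ← map_sum, h2]
      rw [LinearMap.mem_ker.mp hx]; simp
    rw [h1]
    refine Submodule.sum_mem _ fun t _ => Submodule.smul_mem_smul (hrel x h0 t) ?_
    simp [hs']
  obtain ⟨r, hr, hr2⟩ := Submodule.exists_sub_one_mem_and_smul_eq_zero_of_fg_of_le_smul _ _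
    (IsNoetherian.noetherian (LinearMap.ker L)) hker
  have hr0 : r ≠ 0 := by
    rintro rfl
    simp at hr
  have hinj : Function.Injective L := by
    rw [← LinearMap.ker_eq_bot, eq_bot_iff]
    intro x hx
    exact (smul_eq_zero.mp (hr2 x hx)).resolve_left hr0
  exact Module.Free.of_equiv (LinearEquiv.ofBijective L ⟨hinj, hLs⟩)

/-- Step 1: extension modulo `q` after multiplying by an element outside `q`. -/
theorem aux_ext_mod {S : Type} [CommRing S] {m : ℕ} (F : Submodule S (Fin m → S))
    (hfg : F.FG) (q : Ideal S) [q.IsPrime]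
    (hq : ∀ y : F, (∀ j, (y : Fin m → S) j ∈ q) → ∀ φ : Module.Dual S F, φ y ∈ q)
    (φ : Module.Dual S F) :
    ∃ t, t ∉ q ∧ ∃ ψ : Module.Dual S (Fin m → S), ∀ y : F, t * φ y - ψ y ∈ q := by
  classical
  let k := FractionRing (S ⧸ q)
  let ι : S →+* k := (algebraMap (S ⧸ q) k).comp (Ideal.Quotient.mk q)
  have hι : ∀ x, ι x = 0 ↔ x ∈ q := by
    intro x
    simp only [ι, RingHom.comp_apply]
    rw [IsFractionRing.to_map_eq_zero_iff, Ideal.Quotient.eq_zero_iff_mem]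
  have hden : ∀ (r : ℕ) (c : Fin r → k), ∃ t, t ∉ q ∧ ∃ s : Fin r → S, ∀ i, ι t * c i = ι (s i) := by
    intro r c
    obtain ⟨b, hb⟩ := IsLocalization.exist_integer_multiples_of_finite (nonZeroDivisors (S ⧸ q)) c
    obtain ⟨t, ht⟩ := Ideal.Quotient.mk_surjective (b : S ⧸ q)
    have : ∀ i, ∃ s : S, ι t * c i = ι s := by
      intro i
      obtain ⟨s', hs'⟩ := hb i
      obtain ⟨s, rfl⟩ := Ideal.Quotient.mk_surjective s'
      refine ⟨s, ?_⟩
      simp only [ι, RingHom.comp_apply, ht]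
      rw [hs', Algebra.smul_def]
    choose s hs using this
    refine ⟨t, ?_, s, hs⟩
    intro h
    rw [← Ideal.Quotient.eq_zero_iff_mem, ht] at h
    exact nonZeroDivisors.coe_ne_zero b h
  have hfg' : (⊤ : Submodule S F).FG := (Submodule.fg_top F).mpr hfg
  obtain ⟨r, y, hy⟩ := Submodule.fg_iff_exists_fin_generating_family.mp hfg'
  let T : (Fin r → k) →ₗ[k] (Fin m → k) :=
    Fintype.linearCombination k (fun i j => ι ((y i : Fin m → S) j))
  let φk : Module.Dual k (Fin r → k) := Fintype.linearCombination k (fun i => ι (φ (y i)))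
  have hT : ∀ c j, T c j = ∑ i, c i * ι ((y i : Fin m → S) j) := by
    intro c j; simp [T, Fintype.linearCombination_apply]
  have hφk : ∀ c, φk c = ∑ i, c i * ι (φ (y i)) := by
    intro c; simp [φk, Fintype.linearCombination_apply]
  have hker : φk ∈ (LinearMap.ker T).dualAnnihilator := by
    rw [Submodule.mem_dualAnnihilator]
    intro c hc
    obtain ⟨t, ht, s, hs⟩ := hden r c
    have h1 : φ (∑ i, s i • y i) ∈ q := by
      apply hq
      intro j
      rw [← hι]
      have : ι t * T c j = 0 := by rw [LinearMap.mem_ker.mp hc]; simp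
      rw [hT, Finset.mul_sum] at this
      rw [← this]
      simp [← hs, mul_assoc]
    rw [← hι] at h1
    have h2 : ι t * φk c = 0 := by
      rw [← h1, hφk, Finset.mul_sum]
      simp [← hs, mul_assoc]
    exact (mul_eq_zero.mp h2).resolve_left (fun h => ht ((hι t).mp h))
  rw [← LinearMap.range_dualMap_eq_dualAnnihilator_ker] at hker
  obtain ⟨c, hc⟩ := hker
  obtain ⟨t, ht, s, hs⟩ := hden m (fun j => c (Pi.single j 1))
  refine ⟨t, ht, Fintype.linearCombination S s, ?_⟩
  suffices h : (⊤ : Submodule S F) ≤ Submodule.comap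
      (t • φ - (Fintype.linearCombination S s) ∘ₗ F.subtype) q by
    intro z
    exact h (Submodule.mem_top (x := z))
  rw [← hy, Submodule.span_le]
  rintro _ ⟨i, rfl⟩
  change t * φ (y i) - Fintype.linearCombination S s (y i : Fin m → S) ∈ q
  rw [← hι, map_sub, sub_eq_zero, Fintype.linearCombination_apply]
  have h3 : φk (Pi.single i 1) = c (T (Pi.single i 1)) := by rw [← hc]; rfl
  have h4 : φk (Pi.single i 1) = ι (φ (y i)) := by
    rw [hφk]; simp [Pi.single_apply]
  have h5 : T (Pi.single i 1) = fun j => ι ((y i : Fin m → S) j) := by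
    funext j; rw [hT]; simp [Pi.single_apply]
  have h6 : ∀ w : Fin m → k, c w = ∑ j, w j * c (Pi.single j 1) := by
    intro w
    conv_lhs => rw [← Finset.univ_sum_single w, map_sum]
    refine Finset.sum_congr rfl fun j _ => ?_
    rw [← smul_eq_mul, ← map_smul, ← Pi.single_smul]; simp
  rw [map_mul, ← h4, h3, h5, h6, Finset.mul_sum, map_sum]
  refine Finset.sum_congr rfl fun j _ => ?_
  rw [smul_eq_mul, map_mul, ← hs]; ring

/-- Steps 2 and 3. -/
theorem aux_support {S : Type} [CommRing S] [IsNoetherianRing S] {m : ℕ}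
    (F : Submodule S (Fin m → S)) [Module.Projective S F] (q : Ideal S) [hqp : q.IsPrime]
    (hq : ∀ y : F, (∀ j, (y : Fin m → S) j ∈ q) → ∀ φ : Module.Dual S F, φ y ∈ q) :
    ∃ t, t ∉ q ∧ ∀ φ : Module.Dual S F, ∃ ψ : Module.Dual S (Fin m → S),
      ∀ y : F, ψ y = t * φ y := by
  classical
  have hfg : F.FG := IsNoetherian.noetherian F
  have hval : ∀ φ : Module.Dual S F, (∀ y, φ y ∈ q) → φ ∈ q • (⊤ : Submodule S (Module.Dual S F)) := by
    intro φ hφ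
    obtain ⟨r, π, s, -, -, hs⟩ := Module.Finite.exists_comp_eq_id_of_projective S F
    have : φ = ∑ i, φ (π (Pi.single i 1)) • (LinearMap.proj i ∘ₗ s : F →ₗ[S] S) := by
      ext y
      conv_lhs => rw [← show π (s y) = y from congr($hs y), ← Finset.univ_sum_single (s y)]
      simp only [map_sum, LinearMap.sum_apply, LinearMap.smul_apply, LinearMap.comp_apply,
        LinearMap.proj_apply, smul_eq_mul]
      refine Finset.sum_congr rfl fun i _ => ?_
      rw [show (Pi.single i (s y i) : Fin r → S) = (s y i) • Pi.single i (1 : S) by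
        rw [← Pi.single_smul]; simp, map_smul, map_smul, smul_eq_mul, mul_comm]
    rw [this]
    exact Submodule.sum_mem _ fun i _ => Submodule.smul_mem_smul (hφ _) Submodule.mem_top
  let res : Module.Dual S (Fin m → S) →ₗ[S] Module.Dual S F := F.subtype.dualMap
  let B := LinearMap.range res
  let C := Module.Dual S F ⧸ B
  have h1 : ∀ c : C, ∃ t, t ∉ q ∧ t • c ∈ q • (⊤ : Submodule S C) := by
    intro c
    obtain ⟨φ, rfl⟩ := Submodule.mkQ_surjective B c
    obtain ⟨t, ht, ψ, hψ⟩ := aux_ext_mod F hfg q hq φ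
    refine ⟨t, ht, ?_⟩
    have h2 : t • B.mkQ φ = B.mkQ (t • φ - res ψ) := by
      rw [map_sub, map_smul, (Submodule.Quotient.mk_eq_zero B (x := res ψ)).mpr ⟨ψ, rfl⟩ |> (fun h => (h : B.mkQ (res ψ) = 0))]
      simp
    rw [h2]
    have h3 := Submodule.mem_map_of_mem (f := B.mkQ) (hval (t • φ - res ψ) hψ)
    rw [Submodule.map_smul''] at h3
    exact Submodule.smul_mono le_rfl le_top h3
  have hCfg : (⊤ : Submodule S C).FG := Module.Finite.fg_top
  obtain ⟨T, hT⟩ := hCfg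
  choose τ hτ hτ2 using h1
  let t := ∏ c ∈ T, τ c
  have ht : t ∉ q := by
    intro h
    obtain ⟨c, -, hc⟩ := (Ideal.IsPrime.prod_mem_iff).mp h
    exact hτ c hc
  have htC : LinearMap.range (t • (LinearMap.id : C →ₗ[S] C)) ≤ q • (⊤ : Submodule S C) := by
    rw [LinearMap.range_eq_map, ← hT, Submodule.map_span, Submodule.span_le]
    rintro _ ⟨c, hc, rfl⟩
    rw [hT]
    change t • c ∈ q • (⊤ : Submodule S C)
    have : t = (∏ c' ∈ T.erase c, τ c') * τ c := (Finset.prod_erase_mul _ _ hc).symm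
    rw [this, mul_smul]
    exact Submodule.smul_mem _ _ (hτ2 c)
  obtain ⟨P, hPm, hPd, hPc, hP⟩ :=
    LinearMap.exists_monic_and_natDegree_eq_and_coeff_mem_pow_and_aeval_eq_zero S _ q htC
  have hPt : ∀ c : C, P.eval t • c = 0 := by
    intro c
    have : Polynomial.aeval (t • (LinearMap.id : C →ₗ[S] C)) P = algebraMap S (Module.End S C) (P.eval t) := by
      have h : (t • (LinearMap.id : C →ₗ[S] C)) = algebraMap S (Module.End S C) t := by
        ext; rfl
      rw [h, Polynomial.aeval_algebraMap_apply]; simp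
    rw [this] at hP
    exact congr($hP c)
  refine ⟨P.eval t, ?_, ?_⟩
  · intro h
    rw [Polynomial.eval_eq_sum_range, Finset.sum_range_succ, hPm.coeff_natDegree, one_mul] at h
    have h2 : ∑ x ∈ Finset.range P.natDegree, P.coeff x * t ^ x ∈ q := by
      refine Submodule.sum_mem _ fun x hx => Ideal.mul_mem_right _ _ ?_
      exact Ideal.pow_le_self (by simp at hx; omega) (hPc x)
    exact ht (hqp.mem_of_pow_mem _ ((Ideal.add_mem_iff_right _ h2).mp h))
  · intro φ
    have h := hPt (B.mkQ φ)
    rw [← map_smul, Submodule.mkQ_apply, Submodule.Quotient.mk_eq_zero] at h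
    obtain ⟨ψ, hψ⟩ := h
    exact ⟨ψ, fun y => congr($hψ y)⟩

theorem aux_avoid {S : Type} [CommRing S] [IsNoetherianRing S] (I p : Ideal S)
    (h : ∀ q ∈ associatedPrimes S (S ⧸ I), ¬ p ≤ q) : ∃ x ∈ p, ∀ y, x * y ∈ I → y ∈ I := by
  by_contra! hc
  have hsub : (p : Set S) ⊆ ⋃ q ∈ associatedPrimes S (S ⧸ I), (q : Set S) := by
    rw [biUnion_associatedPrimes_eq_zero_divisors]
    intro x hx
    obtain ⟨y, hy1, hy2⟩ := hc x hx
    refine ⟨Ideal.Quotient.mk I y, ?_, ?_⟩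
    · rwa [Ne, Ideal.Quotient.eq_zero_iff_mem]
    · rw [← Ideal.Quotient.eq_zero_iff_mem, map_mul] at hy1
      exact hy1
  obtain ⟨q, hq, hpq⟩ := (Ideal.subset_union_prime_finite (associatedPrimes.finite S (S ⧸ I)) ⊥ ⊥
    (fun I hin _ _ ↦ IsAssociatedPrime.isPrime hin)).mp hsub
  exact h q hq hpq

/-- A prime containing a regular sequence of length three has height different from two. -/
theorem aux_height {S : Type} [CommRing S] [IsDomain S] (q : Ideal S) (hq : q.IsPrime) (a b d : S)
    (ha : a ∈ q) (hb : b ∈ q) (hd : d ∈ q) (ha0 : a ≠ 0)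
    (hab : ∀ y, b * y ∈ Ideal.span {a} → y ∈ Ideal.span {a})
    (habd : ∀ y, d * y ∈ Ideal.span {a, b} → y ∈ Ideal.span {a, b}) :
    Order.height (⟨q, hq⟩ : PrimeSpectrum S) ≠ 2 := by
  obtain ⟨q2, hq2, hle2⟩ := Ideal.exists_minimalPrimes_le (I := Ideal.span {a, b}) (J := q) (by
    rw [Ideal.span_le]; rintro x (rfl | rfl) <;> assumption)
  have hp2 : q2.IsPrime := hq2.isPrime
  have hd2 : d ∉ q2 := by
    intro h
    obtain ⟨y, hy, hy2⟩ := Ideal.exists_mul_mem_of_mem_minimalPrimes hq2 h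
    exact hy (habd y hy2)
  have ha2 : a ∈ q2 := hq2.1.2 (Ideal.subset_span (by simp))
  have hb2 : b ∈ q2 := hq2.1.2 (Ideal.subset_span (by simp))
  obtain ⟨q1, hq1, hle1⟩ := Ideal.exists_minimalPrimes_le (I := Ideal.span {a}) (J := q2) (by
    rw [Ideal.span_le]; rintro x rfl; assumption)
  have hp1 : q1.IsPrime := hq1.isPrime
  have hb1 : b ∉ q1 := by
    intro h
    obtain ⟨y, hy, hy2⟩ := Ideal.exists_mul_mem_of_mem_minimalPrimes hq1 h
    exact hy (hab y hy2)
  have ha1 : a ∈ q1 := hq1.1.2 (Ideal.subset_span (by simp))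
  let P0 : PrimeSpectrum S := ⟨⊥, Ideal.isPrime_bot⟩
  let P1 : PrimeSpectrum S := ⟨q1, hp1⟩
  let P2 : PrimeSpectrum S := ⟨q2, hp2⟩
  let P3 : PrimeSpectrum S := ⟨q, hq⟩
  have l01 : P0 < P1 := by
    refine lt_of_le_of_ne (bot_le (a := q1)) ?_
    intro h
    have : (⊥ : Ideal S) = q1 := congr_arg PrimeSpectrum.asIdeal h
    rw [← this] at ha1
    exact ha0 (by simpa using ha1)
  have l12 : P1 < P2 := by
    refine lt_of_le_of_ne hle1 ?_
    intro h
    have : q1 = q2 := congr_arg PrimeSpectrum.asIdeal h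
    exact hb1 (this ▸ hb2)
  have l23 : P2 < P3 := by
    refine lt_of_le_of_ne hle2 ?_
    intro h
    have : q2 = q := congr_arg PrimeSpectrum.asIdeal h
    exact hd2 (this ▸ hd)
  have h1 := Order.height_add_one_le l01
  have h2 := Order.height_add_one_le l12
  have h3 := Order.height_add_one_le l23
  intro h
  change Order.height P3 = 2 at h
  have h5 : ((3 : ℕ) : ℕ∞) ≤ Order.height P3 := by
    calc ((3 : ℕ) : ℕ∞) = 0 + 1 + 1 + 1 := by norm_num
      _ ≤ Order.height P0 + 1 + 1 + 1 := by gcongr; exact zero_le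
      _ ≤ Order.height P1 + 1 + 1 := by gcongr
      _ ≤ Order.height P2 + 1 := by gcongr
      _ ≤ Order.height P3 := h3
  rw [h] at h5
  exact absurd h5 (by decide)

theorem aux_koszul {S : Type} [CommRing S] [IsDomain S] (a b d : S) (ha0 : a ≠ 0)
    (hab : ∀ y, b * y ∈ Ideal.span {a} → y ∈ Ideal.span {a})
    (habd : ∀ y, d * y ∈ Ideal.span {a, b} → y ∈ Ideal.span {a, b})
    (eab ead ebd : S) (h : d * eab - b * ead + a * ebd = 0) :
    ∃ εa εb εd, eab = b * εa - a * εb ∧ ead = d * εa - a * εd ∧ ebd = d * εb - b * εd := by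
  have h1 : eab ∈ Ideal.span {a, b} := by
    apply habd
    rw [Ideal.mem_span_pair]
    exact ⟨-ebd, ead, by linear_combination -h⟩
  obtain ⟨u, v, huv⟩ := Ideal.mem_span_pair.mp h1
  have h2 : d * v - ead ∈ Ideal.span {a} := by
    apply hab
    rw [Ideal.mem_span_singleton]
    exact ⟨-(ebd + d * u), by linear_combination h + d * huv⟩
  obtain ⟨w, hw⟩ := Ideal.mem_span_singleton.mp h2
  refine ⟨v, -u, w, by linear_combination -huv, by linear_combination -hw, ?_⟩
  apply mul_left_cancel₀ ha0
  linear_combination h + d * huv - b * hw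

theorem aux_koszul_D {S : Type} [CommRing S] [IsDomain S] {ℓ : ℕ}
    (g : (Fin ℓ → S) →ₗ[S] S) (f : S) (hf0 : f ≠ 0) (J : Ideal S) (hJ : J = LinearMap.range g)
    (hfJ : f ∈ J)
    (D : Submodule S (Fin ℓ → S)) (hD : D = Submodule.comap g (Ideal.span {f}))
    (a b d : S) (ha0 : a ≠ 0)
    (haJ : ∀ y, a * y ∈ J → y ∈ J)
    (hab : ∀ y, b * y ∈ Ideal.span {a} → y ∈ Ideal.span {a})
    (habd : ∀ y, d * y ∈ Ideal.span {a, b} → y ∈ Ideal.span {a, b})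
    (Dab Dad Dbd : D) (h : d • Dab - b • Dad + a • Dbd = 0) :
    ∃ δa δb : D, Dab = b • δa - a • δb := by
  have hmem : ∀ θ : Fin ℓ → S, θ ∈ D ↔ ∃ k, g θ = f * k := by
    intro θ
    rw [hD, Submodule.mem_comap, Ideal.mem_span_singleton]; rfl
  have h0 : d • (Dab : Fin ℓ → S) - b • (Dad : Fin ℓ → S) + a • (Dbd : Fin ℓ → S) = 0 := by
    simpa using congr_arg Subtype.val h
  have hc := fun i => aux_koszul a b d ha0 hab habd ((Dab : Fin ℓ → S) i) ((Dad : Fin ℓ → S) i)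
    ((Dbd : Fin ℓ → S) i) (by simpa using congr_fun h0 i)
  choose εa εb εd e1 e2 e3 using hc
  have E1 : (Dab : Fin ℓ → S) = b • εa - a • εb := funext e1
  have E2 : (Dad : Fin ℓ → S) = d • εa - a • εd := funext e2
  have E3 : (Dbd : Fin ℓ → S) = d • εb - b • εd := funext e3
  obtain ⟨kab, hkab⟩ := (hmem _).mp Dab.2
  obtain ⟨kad, hkad⟩ := (hmem _).mp Dad.2
  obtain ⟨kbd, hkbd⟩ := (hmem _).mp Dbd.2
  have hk : d * kab - b * kad + a * kbd = 0 := by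
    apply mul_left_cancel₀ hf0
    have := congr_arg g h0
    simp only [map_add, map_sub, map_smul, smul_eq_mul, hkab, hkad, hkbd, map_zero] at this
    linear_combination this
  obtain ⟨ka, kb, kd, k1, k2, k3⟩ := aux_koszul a b d ha0 hab habd kab kad kbd hk
  rw [E1, map_sub, map_smul, map_smul, smul_eq_mul, smul_eq_mul] at hkab
  have h4 : g εa - f * ka ∈ Ideal.span {a} := by
    apply hab
    rw [Ideal.mem_span_singleton]
    exact ⟨g εb - f * kb, by linear_combination hkab + f * k1⟩
  obtain ⟨w, hw⟩ := Ideal.mem_span_singleton.mp h4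
  have hw2 : g εb - f * kb = b * w := by
    apply mul_left_cancel₀ ha0
    linear_combination b * hw - hkab - f * k1
  have hwJ : w ∈ J := by
    apply haJ
    rw [← hw]
    refine J.sub_mem ?_ (J.mul_mem_right _ hfJ)
    rw [hJ]; exact ⟨εa, rfl⟩
  rw [hJ] at hwJ
  obtain ⟨η, hη⟩ := hwJ
  refine ⟨⟨εa - a • η, (hmem _).mpr ⟨ka, ?_⟩⟩, ⟨εb - b • η, (hmem _).mpr ⟨kb, ?_⟩⟩, ?_⟩
  · rw [map_sub, map_smul, hη, smul_eq_mul]; linear_combination hw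
  · rw [map_sub, map_smul, hη, smul_eq_mul]; linear_combination hw2
  · apply Subtype.ext
    change (Dab : Fin ℓ → S) = b • (εa - a • η) - a • (εb - b • η)
    rw [E1]
    funext i
    simp only [Pi.sub_apply, Pi.smul_apply, smul_eq_mul]
    ring

/-- `D` is reflexive. -/
theorem aux_reflexive {S : Type} [CommRing S] [IsDomain S] {ℓ : ℕ}
    (g : (Fin ℓ → S) →ₗ[S] S) (f : S) (hf0 : f ≠ 0)
    (D : Submodule S (Fin ℓ → S)) (hD : D = Submodule.comap g (Ideal.span {f})) :
    Function.Bijective (Module.Dual.eval S D) := by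
  have hmem : ∀ θ : Fin ℓ → S, θ ∈ D ↔ ∃ k, g θ = f * k := by
    intro θ
    rw [hD, Submodule.mem_comap, Ideal.mem_span_singleton]; rfl
  let e : Fin ℓ → Module.Dual S D := fun i => LinearMap.proj i ∘ₗ D.subtype
  have hg : ∀ θ : Fin ℓ → S, g θ = ∑ i, θ i * g (Pi.single i 1) := by
    intro θ
    conv_lhs => rw [← Finset.univ_sum_single θ, map_sum]
    refine Finset.sum_congr rfl fun j _ => ?_
    rw [← smul_eq_mul, ← map_smul, ← Pi.single_smul]; simp
  constructor
  · intro x y hxy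
    apply Subtype.ext
    funext i
    exact congr($hxy (e i))
  · intro ξ
    have hk : ∀ θ : D, ∃ k, g θ = f * k := fun θ => (hmem _).mp θ.2
    choose k hk using hk
    let κ : Module.Dual S D :=
      { toFun := k
        map_add' := fun x y => by
          apply mul_left_cancel₀ hf0
          rw [← hk, mul_add, ← hk, ← hk]; simp
        map_smul' := fun r x => by
          apply mul_left_cancel₀ hf0
          rw [← hk]; simp only [RingHom.id_apply, smul_eq_mul]
          rw [mul_left_comm, ← hk]; simp }
    have hκ : ∑ i, g (Pi.single i 1) • e i = f • κ := by
      ext θ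
      simp only [LinearMap.sum_apply, LinearMap.smul_apply, smul_eq_mul]
      change _ = f * k θ
      rw [← hk, hg]
      refine Finset.sum_congr rfl fun j _ => ?_
      rw [mul_comm]; rfl
    let θ : D := ⟨fun i => ξ (e i), (hmem _).mpr ⟨ξ κ, by
      rw [← smul_eq_mul (a := f), ← map_smul, ← hκ, map_sum, hg]
      refine Finset.sum_congr rfl fun j _ => ?_
      rw [map_smul, smul_eq_mul, mul_comm]⟩⟩
    refine ⟨θ, ?_⟩
    ext ω
    let v : Fin ℓ → D := fun i => ⟨f • Pi.single i 1, (hmem _).mpr ⟨g (Pi.single i 1), by simp⟩⟩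
    have hv : ∀ x : D, f • x = ∑ i, e i x • v i := by
      intro x
      apply Subtype.ext
      rw [Submodule.coe_smul, AddSubmonoidClass.coe_finsetSum]
      funext j
      simp [v, e, Pi.single_apply, mul_comm]
    have hω : f • ω = ∑ i, ω (v i) • e i := by
      ext x
      rw [LinearMap.smul_apply, ← map_smul, hv, map_sum, LinearMap.sum_apply]
      refine Finset.sum_congr rfl fun j _ => ?_
      rw [map_smul, LinearMap.smul_apply, smul_eq_mul, smul_eq_mul, mul_comm]
    change ω θ = ξ ω
    apply mul_left_cancel₀ hf0
    rw [← smul_eq_mul, ← smul_eq_mul, ← map_smul, ← map_smul, hω, hv, map_sum, map_sum]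
    refine Finset.sum_congr rfl fun j _ => ?_
    rw [map_smul, map_smul, smul_eq_mul, smul_eq_mul, mul_comm]; rfl

/-- Divisibility of functionals. -/
theorem aux_div {S M : Type} [CommRing S] [IsDomain S] [AddCommGroup M] [Module S M] (a : S)
    (ha0 : a ≠ 0) (φ : Module.Dual S M) (h : ∀ x, φ x ∈ Ideal.span {a}) :
    ∃ χ : Module.Dual S M, φ = a • χ := by
  have h' : ∀ x, ∃ k, φ x = a * k := fun x => Ideal.mem_span_singleton.mp (h x)
  choose k hk using h'
  exact ⟨{ toFun := k
           map_add' := fun x y => by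
             apply mul_left_cancel₀ ha0
             rw [← hk, mul_add, ← hk, ← hk]; simp
           map_smul' := fun r x => by
             apply mul_left_cancel₀ ha0
             rw [← hk]; simp only [RingHom.id_apply, smul_eq_mul]
             rw [mul_left_comm, ← hk]; simp }, LinearMap.ext hk⟩

theorem core_ext {S : Type} [CommRing S] [IsDomain S] [IsNoetherianRing S] {ℓ m : ℕ}
    (g : (Fin ℓ → S) →ₗ[S] S) (f : S) (hf0 : f ≠ 0) (J : Ideal S) (hJ : J = LinearMap.range g)
    (hfJ : f ∈ J)
    (D : Submodule S (Fin ℓ → S)) (hD : D = Submodule.comap g (Ideal.span {f}))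
    (hass : ∀ (q : Ideal S) (hq : q.IsPrime), q ∈ associatedPrimes S (S ⧸ J) →
      Order.height (⟨q, hq⟩ : PrimeSpectrum S) = 2)
    (π : (Fin m → S) →ₗ[S] Module.Dual S D) (hπ : Function.Surjective π)
    [Module.Projective S (LinearMap.ker π)] (φ0 : Module.Dual S (LinearMap.ker π)) :
    ∃ ψ : Module.Dual S (Fin m → S), ∀ y : LinearMap.ker π, ψ y = φ0 y := by
  by_contra hφ0
  let F := LinearMap.ker π
  let res : Module.Dual S (Fin m → S) →ₗ[S] Module.Dual S F := F.subtype.dualMap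
  let B := LinearMap.range res
  have hx0 : B.mkQ φ0 ≠ 0 := by
    intro h
    rw [Submodule.mkQ_apply, Submodule.Quotient.mk_eq_zero] at h
    obtain ⟨ψ, hψ⟩ := h
    exact hφ0 ⟨ψ, fun y => congr($hψ y)⟩
  obtain ⟨p, hp, -⟩ := exists_le_isAssociatedPrime_of_isNoetherianRing S _ hx0
  obtain ⟨hpp, c, hc⟩ := isAssociatedPrime_iff.mp hp
  obtain ⟨φ, rfl⟩ := Submodule.mkQ_surjective B c
  have hpφ : ∀ t, t ∈ p ↔ ∃ ψ : Module.Dual S (Fin m → S), ∀ y : F, ψ y = t * φ y := by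
    intro t
    rw [hc, Submodule.mem_colon_singleton, Submodule.mem_bot, ← map_smul, Submodule.mkQ_apply,
      Submodule.Quotient.mk_eq_zero]
    constructor
    · rintro ⟨ψ, hψ⟩
      exact ⟨ψ, fun y => congr($hψ y)⟩
    · rintro ⟨ψ, hψ⟩
      exact ⟨ψ, LinearMap.ext hψ⟩
  -- no prime of low grade contains `p`
  have hlow : ∀ I : Ideal S, (∀ z : F, (∀ j, (z : Fin m → S) j ∈ I) →
      ∀ φ : Module.Dual S F, φ z ∈ I) → ∃ x ∈ p, ∀ y, x * y ∈ I → y ∈ I := by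
    intro I hI
    apply aux_avoid
    intro q hq hpq
    obtain ⟨hqp, s', hs'⟩ := isAssociatedPrime_iff.mp hq
    obtain ⟨s, rfl⟩ := Ideal.Quotient.mk_surjective s'
    have hqs : ∀ x, x ∈ q ↔ x * s ∈ I := by
      intro x
      rw [hs', Submodule.mem_colon_singleton, Submodule.mem_bot, ← Ideal.Quotient.eq_zero_iff_mem,
        map_mul]; rfl
    obtain ⟨t, ht, hext⟩ := aux_support F q (by
      intro y hy φ'
      rw [hqs, mul_comm, ← smul_eq_mul, ← map_smul]
      apply hI
      intro j
      have := (hqs _).mp (hy j)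
      rwa [mul_comm] at this)
    exact ht (hpq ((hpφ t).mpr (hext φ)))
  obtain ⟨a0, ha0p, ha00⟩ : ∃ a ∈ p, a ≠ 0 := by
    obtain ⟨x, hx, h⟩ := hlow ⊥ (by
      intro z hz φ'
      have : z = 0 := by
        apply Subtype.ext; funext j; exact hz j
      rw [this, map_zero]; exact Submodule.zero_mem _)
    refine ⟨x, hx, ?_⟩
    rintro rfl
    have := h 1 (by simp)
    simp at this
  have hb : ∀ a ∈ p, a ≠ 0 → ∃ b ∈ p, ∀ y, b * y ∈ Ideal.span {a} → y ∈ Ideal.span {a} := by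
    intro a _ ha
    apply hlow
    intro z hz φ'
    choose u hu using fun j => Ideal.mem_span_singleton.mp (hz j)
    have hzu : (z : Fin m → S) = a • u := funext hu
    have hu0 : u ∈ F := by
      have h1 : π z = 0 := z.2
      rw [hzu, map_smul] at h1
      rw [LinearMap.mem_ker]
      ext x
      have := congr($h1 x)
      simpa [ha] using this
    have : z = a • (⟨u, hu0⟩ : F) := Subtype.ext hzu
    rw [this, map_smul, Ideal.mem_span_singleton]
    exact ⟨_, rfl⟩
  have hd : ∀ a ∈ p, a ≠ 0 → ∀ b ∈ p, (∀ y, b * y ∈ Ideal.span {a} → y ∈ Ideal.span {a}) →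
      ∃ d ∈ p, ∀ y, d * y ∈ Ideal.span {a, b} → y ∈ Ideal.span {a, b} := by
    intro a _ ha b _ hab
    apply hlow
    intro z hz φ'
    choose u v huv using fun j => Ideal.mem_span_pair.mp (hz j)
    have hzu : (z : Fin m → S) = a • u + b • v := by
      funext j; simp [← huv j, mul_comm]
    have h1 : π z = 0 := z.2
    rw [hzu, map_add, map_smul, map_smul] at h1
    have h1' : ∀ x, a * π u x + b * π v x = 0 := fun x => congr($h1 x)
    obtain ⟨w, hw⟩ := aux_div a ha (π v) (by
      intro x
      apply hab
      rw [Ideal.mem_span_singleton]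
      exact ⟨- π u x, by linear_combination h1' x⟩)
    obtain ⟨w', rfl⟩ := hπ w
    have hw2 : π u = - b • π w' := by
      ext x
      apply mul_left_cancel₀ ha
      have h2 := h1' x
      rw [hw] at h2
      simp only [LinearMap.smul_apply, smul_eq_mul] at h2 ⊢
      linear_combination h2
    have hu0 : u + b • w' ∈ F := by
      rw [LinearMap.mem_ker, map_add, map_smul, hw2]
      ext x
      simp only [LinearMap.add_apply, LinearMap.smul_apply, smul_eq_mul, LinearMap.zero_apply]
      ring
    have hv0 : v - a • w' ∈ F := by
      rw [LinearMap.mem_ker, map_sub, map_smul, hw]; simp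
    have : z = a • (⟨_, hu0⟩ : F) + b • (⟨_, hv0⟩ : F) := by
      apply Subtype.ext
      rw [hzu]
      change _ = a • (u + b • w') + b • (v - a • w')
      funext j
      simp only [Pi.add_apply, Pi.sub_apply, Pi.smul_apply, smul_eq_mul]
      ring
    rw [this, map_add, map_smul, map_smul, Ideal.mem_span_pair]
    exact ⟨φ' ⟨_, hu0⟩, φ' ⟨_, hv0⟩, by rw [smul_eq_mul, smul_eq_mul, mul_comm a, mul_comm b]⟩
  obtain ⟨a, hap, ha, haJ⟩ : ∃ a ∈ p, a ≠ 0 ∧ ∀ y, a * y ∈ J → y ∈ J := by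
    obtain ⟨b0, hb0, hab0⟩ := hb a0 ha0p ha00
    obtain ⟨d0, hd0, habd0⟩ := hd a0 ha0p ha00 b0 hb0 hab0
    obtain ⟨x, hx, h⟩ := aux_avoid J p (by
      intro q hq hpq
      have hqp := IsAssociatedPrime.isPrime hq
      exact aux_height q hqp a0 b0 d0 (hpq ha0p) (hpq hb0) (hpq hd0) ha00 hab0 habd0
        (hass q hqp hq))
    by_cases hx0 : x = 0
    · refine ⟨a0, ha0p, ha00, fun y _ => h y ?_⟩
      rw [hx0, zero_mul]; exact J.zero_mem
    · exact ⟨x, hx, hx0, h⟩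
  obtain ⟨b, hbp, hab⟩ := hb a hap ha
  obtain ⟨d, hdp, habd⟩ := hd a hap ha b hbp hab
  obtain ⟨ψa, hψa⟩ := (hpφ a).mp hap
  obtain ⟨ψb, hψb⟩ := (hpφ b).mp hbp
  obtain ⟨ψd, hψd⟩ := (hpφ d).mp hdp
  obtain ⟨hevi, hevs⟩ := aux_reflexive g f hf0 D hD
  have hfac : ∀ E : Module.Dual S (Fin m → S), (∀ y : F, E y = 0) →
      ∃ δ : D, ∀ z, E z = π z δ := by
    intro E hE
    have hE' : E ∈ (LinearMap.ker π).dualAnnihilator := by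
      rw [Submodule.mem_dualAnnihilator]
      intro w hw
      exact hE ⟨w, hw⟩
    rw [← LinearMap.range_dualMap_eq_dualAnnihilator_ker_of_surjective π hπ] at hE'
    obtain ⟨ξ, hξ⟩ := hE'
    obtain ⟨δ, rfl⟩ := hevs ξ
    refine ⟨δ, fun z => ?_⟩
    rw [← hξ]; rfl
  obtain ⟨Dab, hDab⟩ := hfac (b • ψa - a • ψb) (by
    intro y; simp only [LinearMap.sub_apply, LinearMap.smul_apply, smul_eq_mul, hψa, hψb]; ring)
  obtain ⟨Dad, hDad⟩ := hfac (d • ψa - a • ψd) (by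
    intro y; simp only [LinearMap.sub_apply, LinearMap.smul_apply, smul_eq_mul, hψa, hψd]; ring)
  obtain ⟨Dbd, hDbd⟩ := hfac (d • ψb - b • ψd) (by
    intro y; simp only [LinearMap.sub_apply, LinearMap.smul_apply, smul_eq_mul, hψd, hψb]; ring)
  obtain ⟨δa, δb, hδ⟩ := aux_koszul_D g f hf0 J hJ hfJ D hD a b d ha haJ hab habd Dab Dad Dbd (by
    apply hevi
    ext ω
    obtain ⟨z, rfl⟩ := hπ ω
    rw [map_zero, LinearMap.zero_apply]
    change π z (d • Dab - b • Dad + a • Dbd) = 0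
    simp only [map_add, map_sub, map_smul, ← hDab, ← hDad, ← hDbd, LinearMap.sub_apply,
      LinearMap.smul_apply, smul_eq_mul]
    ring)
  have hfin : ∀ z, b * (ψa z - π z δa) = a * (ψb z - π z δb) := by
    intro z
    have := hDab z
    rw [hδ] at this
    simp only [map_sub, map_smul, LinearMap.sub_apply, LinearMap.smul_apply, smul_eq_mul] at this
    linear_combination this
  obtain ⟨χ, hχ⟩ := aux_div a ha (ψa - Module.Dual.eval S D δa ∘ₗ π) (by
    intro z
    apply hab
    rw [Ideal.mem_span_singleton]
    exact ⟨_, hfin z⟩)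
  apply hpp.ne_top
  rw [Ideal.eq_top_iff_one, hpφ]
  refine ⟨χ, fun y => ?_⟩
  apply mul_left_cancel₀ ha
  have h1 : ψa y - π y δa = a * χ y := congr($hχ y)
  have h2 : π y = 0 := y.2
  rw [h2, LinearMap.zero_apply, sub_zero, hψa] at h1
  rw [← h1, one_mul]

theorem core_projective {S : Type} [CommRing S] [IsDomain S] [IsNoetherianRing S] {ℓ : ℕ}
    (g : (Fin ℓ → S) →ₗ[S] S) (f : S) (hf0 : f ≠ 0) (J : Ideal S) (hJ : J = LinearMap.range g)
    (hfJ : f ∈ J)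
    (D : Submodule S (Fin ℓ → S)) (hD : D = Submodule.comap g (Ideal.span {f}))
    (hass : ∀ (q : Ideal S) (hq : q.IsPrime), q ∈ associatedPrimes S (S ⧸ J) →
      Order.height (⟨q, hq⟩ : PrimeSpectrum S) = 2)
    (hpd : pdLE S (ModuleCat.of S (Module.Dual S D)) 1) : Module.Projective S D := by
  have hfin : Module.Finite S (Module.Dual S D) := by
    obtain ⟨r, p, hp⟩ := Module.Finite.exists_fin' S D
    exact Module.Finite.of_injective p.dualMap (LinearMap.dualMap_injective_of_surjective hp)
  obtain ⟨m, π, hπ⟩ := Module.Finite.exists_fin' S (Module.Dual S D)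
  have hker : Module.Projective S (LinearMap.ker π) :=
    proj_of_pdLE S (ModuleCat.of S (Module.Dual S D)) hpd (Fin m → S) π hπ
  have hext := core_ext g f hf0 J hJ hfJ D hD hass π hπ
  choose ψ hψ using hext
  obtain ⟨r, p, s, -, -, hs⟩ := Module.Finite.exists_comp_eq_id_of_projective S (LinearMap.ker π)
  let ρ : (Fin m → S) →ₗ[S] LinearMap.ker π :=
    p ∘ₗ LinearMap.pi fun i => ψ (LinearMap.proj i ∘ₗ s)
  have hρ : ∀ y : LinearMap.ker π, ρ y = y := by
    intro y
    have h1 : (LinearMap.pi fun i => ψ (LinearMap.proj i ∘ₗ s)) (y : Fin m → S) = s y := by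
      funext i
      exact hψ _ y
    have h2 : p (s y) = y := congr($hs y)
    change p ((LinearMap.pi fun i => ψ (LinearMap.proj i ∘ₗ s)) (y : Fin m → S)) = y
    rw [h1, h2]
  have hΩ : Module.Projective S (LinearMap.range π) :=
    aux_split π ((LinearMap.ker π).subtype ∘ₗ ρ)
      (fun x hx => congr_arg Subtype.val (hρ ⟨x, hx⟩)) (fun x => (ρ x).2)
  have hΩ' : Module.Projective S (Module.Dual S D) := by
    rw [LinearMap.range_eq_top.mpr hπ] at hΩ
    exact Module.Projective.of_equiv Submodule.topEquiv
  exact Module.Projective.of_equiv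
    (LinearEquiv.ofBijective _ (aux_reflexive g f hf0 D hD)).symm

/-- Let `K` be a field of characteristic zero, `S = K[x_1, …, x_ℓ]`, and
`f = α_1 ⋯ α_n` a product of pairwise non-proportional nonzero linear forms (a central
hyperplane arrangement).  If `pd_S Ω^1(f) ≤ 1` and every associated prime of `S/J_f`
has height exactly `2`, then `D(f)` is a free `S`-module. -/
theorem arrangement_free_of_jacobian_pure (K : Type) [Field K] [CharZero K] (ℓ n : ℕ)
    (α : Fin n → MvPolynomial (Fin ℓ) K)
    (hlin : ∀ i, α i ≠ 0 ∧ (α i).IsHomogeneous 1)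
    (hprop : ∀ i j, i ≠ j → ∀ c : K, α j ≠ c • α i)
    (f : MvPolynomial (Fin ℓ) K) (hf : f = ∏ i, α i)
    (hpd : pdLE (MvPolynomial (Fin ℓ) K)
      (ModuleCat.of (MvPolynomial (Fin ℓ) K)
        (Module.Dual (MvPolynomial (Fin ℓ) K) (Dlog K ℓ f))) 1)
    (hass : ∀ (q : Ideal (MvPolynomial (Fin ℓ) K)) (hq : q.IsPrime),
      q ∈ associatedPrimes (MvPolynomial (Fin ℓ) K)
        (MvPolynomial (Fin ℓ) K ⧸ jacobianIdeal K ℓ f) →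
      Order.height (⟨q, hq⟩ : PrimeSpectrum (MvPolynomial (Fin ℓ) K)) = 2) :
    Module.Free (MvPolynomial (Fin ℓ) K) (Dlog K ℓ f) := by
  let S := MvPolynomial (Fin ℓ) K
  let g : (Fin ℓ → S) →ₗ[S] S := ∑ i : Fin ℓ, (LinearMap.toSpanSingleton S S (pderiv i f)).comp
    (LinearMap.proj i)
  have hg : ∀ θ, g θ = ∑ i, θ i * pderiv i f := by
    intro θ
    simp [g, LinearMap.sum_apply]
  have hD : Dlog K ℓ f = Submodule.comap g (Ideal.span {f}) := rfl
  have hf0 : f ≠ 0 := by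
    rw [hf]
    exact Finset.prod_ne_zero_iff.mpr fun i _ => (hlin i).1
  have hfh : f.IsHomogeneous n := by
    rw [hf]
    have := IsHomogeneous.prod Finset.univ α (fun _ => 1) (fun i _ => (hlin i).2)
    simpa using this
  have hmem : ∀ θ : Fin ℓ → S, θ ∈ Dlog K ℓ f ↔ f ∣ ∑ i, θ i * pderiv i f := by
    intro θ
    rw [hD, Submodule.mem_comap, Ideal.mem_span_singleton, hg]
  rcases Nat.eq_zero_or_pos n with hn | hn
  · subst hn
    have hf1 : f = 1 := by rw [hf]; simp
    have htop : Dlog K ℓ f = ⊤ := by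
      rw [eq_top_iff]
      intro θ _
      rw [hmem, hf1]
      exact one_dvd _
    rw [htop]
    exact Module.Free.of_equiv Submodule.topEquiv.symm
  have hJ : jacobianIdeal K ℓ f = LinearMap.range g := by
    apply le_antisymm
    · rw [jacobianIdeal, Ideal.span_le]
      rintro _ ⟨i, rfl⟩
      refine ⟨Pi.single i 1, ?_⟩
      rw [hg]; simp [Pi.single_apply]
    · rintro _ ⟨θ, rfl⟩
      rw [hg]
      exact Submodule.sum_mem _ fun i _ =>
        Ideal.mul_mem_left _ _ (Ideal.subset_span ⟨i, rfl⟩)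
  have hfJ : f ∈ jacobianIdeal K ℓ f := by
    rw [hJ]
    refine ⟨fun i => C ((n : K)⁻¹) * X i, ?_⟩
    have h := hfh.sum_X_mul_pderiv
    rw [hg]
    simp only [mul_assoc]
    rw [← Finset.mul_sum, h, nsmul_eq_mul, ← mul_assoc]
    have : (C ((n : K)⁻¹) : S) * (n : S) = 1 := by
      rw [← map_natCast (C : K →+* S), ← C_mul, inv_mul_cancel₀ (by exact_mod_cast hn.ne'), C_1]
    rw [this, one_mul]
  have hproj : Module.Projective S (Dlog K ℓ f) :=
    core_projective g f hf0 (jacobianIdeal K ℓ f) hJ hfJ _ hD hass hpd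
  refine free_of_graded_projective (Dlog K ℓ f) ?_
  intro θ hθ d
  rw [hmem] at hθ ⊢
  obtain ⟨k, hk⟩ := hθ
  have h1 : ∀ i, homogeneousComponent d (θ i) * pderiv i f =
      homogeneousComponent (d + (n - 1)) (θ i * pderiv i f) := by
    intro i
    rw [aux_comp_mul _ _ (n - 1) _ hfh.pderiv, if_pos (by omega), Nat.add_sub_cancel]
  simp_rw [h1]
  rw [← map_sum, hk, mul_comm f k, aux_comp_mul _ _ n _ hfh]
  exact dvd_mul_left _ _
end

section
/- Let K be a field of characteristic zero, S = K[x_1, …, x_ℓ] with ℓ ≥ 3, and let α_1, …, α_n be nonzero linear forms with n > ℓ such that every ℓ of them are linearly independent (a generic non-Boolean central arrangement). Set f = α_1 ⋯ α_n. Then the S-module Ext^1_S(Ω^1(f), S) has finite length, equal to the binomial coefficient C(n−1, ℓ). -/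
open CategoryTheory MvPolynomial

section ExtPart
variable {R : Type} [CommRing R] 

def twoX (P0 P1 : ModuleCat.{0} R) : ℕ → ModuleCat.{0} R
  | 0 => P0
  | 1 => P1
  | _ + 2 => ModuleCat.of R PUnit

def twoD {P0 P1 : ModuleCat.{0} R} (d : P1 ⟶ P0) : (n : ℕ) → (twoX P0 P1 (n+1) ⟶ twoX P0 P1 n)
  | 0 => d
  | _ + 1 => 0

noncomputable def twoC {P0 P1 : ModuleCat.{0} R} (d : P1 ⟶ P0) : ChainComplex (ModuleCat.{0} R) ℕ :=
  ChainComplex.of (twoX P0 P1) (twoD d) (fun n => by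
    simp [twoD])

lemma twoC_d10 {P0 P1 : ModuleCat.{0} R} (d : P1 ⟶ P0) : (twoC d).d 1 0 = d :=
  ChainComplex.of_d (twoX P0 P1) (twoD d) 0

lemma twoC_d {P0 P1 : ModuleCat.{0} R} (d : P1 ⟶ P0) (n : ℕ) : (twoC d).d (n+2) (n+1) = 0 :=
  ChainComplex.of_d (twoX P0 P1) (twoD d) (n + 1)

lemma twoX_zero (P0 P1 : ModuleCat.{0} R) (n : ℕ) : Limits.IsZero (twoX P0 P1 (n+2)) :=
  ModuleCat.isZero_of_subsingleton (ModuleCat.of R PUnit)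

noncomputable def twoRes {P0 P1 X : ModuleCat.{0} R} (d : P1 ⟶ P0) (e : P0 ⟶ X)
    [Projective P0] [Projective P1] (w : d ≫ e = 0) (hS : (ShortComplex.mk d e w).ShortExact) :
    ProjectiveResolution X where
  complex := twoC d
  projective n := by
    match n with
    | 0 => exact inferInstanceAs (Projective P0)
    | 1 => exact inferInstanceAs (Projective P1)
    | n + 2 => exact (twoX_zero P0 P1 n).projective
  π := (ChainComplex.toSingle₀Equiv _ _).symm ⟨e, by rw [twoC_d10]; exact w⟩
  quasiIso := ⟨fun n => by
    cases n with
    | zero => 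
      rw [ChainComplex.quasiIsoAt₀_iff, ShortComplex.quasiIso_iff_of_zeros']
      · refine (ShortComplex.exact_and_epi_g_iff_of_iso ?_).2
          ⟨hS.exact, hS.epi_g⟩
        exact ShortComplex.isoMk (Iso.refl _) (Iso.refl _) (Iso.refl _)
          (by simp; exact (twoC_d10 d).symm) (by
            have h := ChainComplex.toSingle₀Equiv_symm_apply_f_zero (C := twoC d) (X := X) e
              (by rw [twoC_d10]; exact w)
            refine (Category.id_comp _).trans (Eq.trans ?_ (Category.comp_id _).symm)
            exact h.symm)
      all_goals rfl
    | succ n => 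
      rw [quasiIsoAt_iff_exactAt']
      · rw [HomologicalComplex.exactAt_iff' _ (n + 1 + 1) (n + 1) n (by simp) (by simp)]
        match n with
        | 0 => 
          refine (ShortComplex.exact_iff_mono _ ?_).2 ?_
          · exact twoC_d d 0
          · have := hS.mono_f
            change Mono ((twoC d).d 1 0)
            rw [twoC_d10]; exact this
        | n+1 => 
          exact ShortComplex.exact_of_isZero_X₂ _ (twoX_zero P0 P1 n)
      · apply ChainComplex.exactAt_succ_single_obj⟩


noncomputable def homEquivOfZero (S : ShortComplex (ModuleCat.{0} R)) (h : S.g = 0) :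
    S.homology ≃ₗ[R] (S.X₂ ⧸ LinearMap.range S.f.hom) :=
  haveI := S.isIso_homologyι h
  ((asIso S.homologyι) ≪≫ S.moduleCatOpcyclesIso).toLinearEquiv

lemma ext_equiv {P0 P1 X : ModuleCat.{0} R} (d : P1 ⟶ P0) (e : P0 ⟶ X)
    [Projective P0] [Projective P1] (w : d ≫ e = 0) (hS : (ShortComplex.mk d e w).ShortExact)
    (Y : ModuleCat.{0} R) :
    Nonempty (ExtGrp R X Y 1 ≃ₗ[R] ((P1 →ₗ[R] Y) ⧸ LinearMap.range (LinearMap.lcomp R Y d.hom))) := by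
  let P := twoRes d e w hS
  let C := P.complex.linearYonedaObj R Y
  have e1 : ExtGrp R X Y 1 ≃ₗ[R] C.homology 1 := (P.isoExt 1 Y).toLinearEquiv
  have e2 : C.homology 1 ≅ (C.sc' 0 1 2).homology :=
    ShortComplex.homologyMapIso (C.isoSc' 0 1 2 (by simp) (by simp))
  have hz : (C.sc' 0 1 2).g = 0 := by
    change C.d 1 2 = 0
    ext x
    apply (twoX_zero P0 P1 0).eq_of_src
  suffices e3 : Nonempty (((C.sc' 0 1 2).X₂ ⧸ LinearMap.range (C.sc' 0 1 2).f.hom) ≃ₗ[R]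
      ((P1 →ₗ[R] Y) ⧸ LinearMap.range (LinearMap.lcomp R Y d.hom))) by
    obtain ⟨e3⟩ := e3
    exact ⟨e1.trans (e2.toLinearEquiv.trans ((homEquivOfZero _ hz).trans e3))⟩
  refine ⟨?_⟩
  refine Submodule.Quotient.equiv _ _ (ModuleCat.homLinearEquiv (S := R) (M := P1) (N := Y)) ?_
  have hf : ∀ y : P0 ⟶ Y, (C.sc' 0 1 2).f.hom y = (d ≫ y : P1 ⟶ Y) := by
    intro y
    change (((twoC d).d 1 0) ≫ y : P1 ⟶ Y) = _
    rw [twoC_d10]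
    rfl
  apply le_antisymm
  · rintro _ ⟨_, ⟨y, rfl⟩, rfl⟩
    refine ⟨ModuleCat.Hom.hom (show P0 ⟶ Y from y), ?_⟩
    exact congrArg (fun z : P1 ⟶ Y => z.hom) (hf y).symm
  · rintro _ ⟨y, rfl⟩
    refine ⟨_, ⟨(ModuleCat.ofHom y : P0 ⟶ Y), rfl⟩, ?_⟩
    exact congrArg (fun z : P1 ⟶ Y => z.hom) (hf _)

lemma ext_equiv' {P0 P1 X Y : Type} [AddCommGroup P0] [AddCommGroup P1] [AddCommGroup X]
    [AddCommGroup Y] [Module R P0] [Module R P1] [Module R X] [Module R Y]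
    [Module.Projective R P0] [Module.Projective R P1] (d : P1 →ₗ[R] P0) (e : P0 →ₗ[R] X)
    (hd : Function.Injective d) (hde : Function.Exact d e) (he : Function.Surjective e) :
    Nonempty (ExtGrp R (ModuleCat.of R X) (ModuleCat.of R Y) 1 ≃ₗ[R]
      ((P1 →ₗ[R] Y) ⧸ LinearMap.range (LinearMap.lcomp R Y d))) := by
  have w : ModuleCat.ofHom d ≫ ModuleCat.ofHom e = 0 := by
    ext x; exact hde.apply_apply_eq_zero x
  have : Projective (ModuleCat.of R P0) := ModuleCat.projective_of_categoryTheory_projective _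
  have : Projective (ModuleCat.of R P1) := ModuleCat.projective_of_categoryTheory_projective _
  refine ext_equiv (ModuleCat.ofHom d) (ModuleCat.ofHom e) w ?_ (ModuleCat.of R Y)
  exact ModuleCat.shortComplex_shortExact _ hde hd he

end ExtPart
section ReflPart
variable {R : Type} [CommRing R]

/-- The elementary weak-regularity properties used below. -/
structure RegTriple (a b c : R) : Prop where
  one : ∀ r, a * r = 0 → r = 0
  two : ∀ r s, b * r = a * s → ∃ t, r = a * t
  three : ∀ r s t, c * r = b * s + a * t → ∃ u v, r = b * u + a * v

variable {ι κ : Type} [Fintype ι] [Fintype κ] [DecidableEq ι] [DecidableEq κ]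

lemma RegTriple.dual_one {a b c : R} (h : RegTriple a b c) (f : Module.Dual R (ι → R))
    (hf : a • f = 0) : f = 0 := by
  ext i
  exact h.one _ (by simpa using congrArg (fun g : Module.Dual R (ι → R) => g (Pi.single i 1)) hf)

lemma RegTriple.dual_two {a b c : R} (h : RegTriple a b c) (f g : Module.Dual R (ι → R))
    (hf : b • f = a • g) : ∃ t : Module.Dual R (ι → R), f = a • t := by
  have H : ∀ i, ∃ t, f (Pi.single i 1) = a * t := fun i => 
    h.two _ (g (Pi.single i 1)) (by simpa using congrArg (fun g : Module.Dual R (ι → R) => g (Pi.single i 1)) hf)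
  choose t ht using H
  refine ⟨(Pi.basisFun R ι).constr R t, (Pi.basisFun R ι).ext fun i => ?_⟩
  rw [LinearMap.smul_apply, Module.Basis.constr_basis, Pi.basisFun_apply, ht, smul_eq_mul]

lemma RegTriple.dual_three {a b c : R} (h : RegTriple a b c) (f g k : Module.Dual R (ι → R))
    (hf : c • f = b • g + a • k) : ∃ u v : Module.Dual R (ι → R), f = b • u + a • v := by
  have H : ∀ i, ∃ u v, f (Pi.single i 1) = b * u + a * v := fun i => 
    h.three _ (g (Pi.single i 1)) (k (Pi.single i 1))
      (by simpa using congrArg (fun g : Module.Dual R (ι → R) => g (Pi.single i 1)) hf)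
  choose u v ht using H
  refine ⟨(Pi.basisFun R ι).constr R u, (Pi.basisFun R ι).constr R v,
    (Pi.basisFun R ι).ext fun i => ?_⟩
  rw [LinearMap.add_apply, LinearMap.smul_apply, LinearMap.smul_apply, Module.Basis.constr_basis,
    Module.Basis.constr_basis, Pi.basisFun_apply, ht, smul_eq_mul, smul_eq_mul]

lemma dual_inj (A : (ι → R) →ₗ[R] (κ → R)) {a b c : R} (h : RegTriple a b c)
    (sa : (κ → R) →ₗ[R] (ι → R)) (ha : ∀ v, A (sa v) = a • v) :
     Function.Injective A.dualMap := by
  rw [injective_iff_map_eq_zero]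
  intro χ hχ
  apply h.dual_one
  ext v
  have := congrArg (fun g : Module.Dual R (ι → R) => g (sa (Pi.single v 1))) hχ
  simpa [ha] using this

lemma dual_exact (A : (ι → R) →ₗ[R] (κ → R)) {a b c : R} (h : RegTriple a b c)
    (sa sb : (κ → R) →ₗ[R] (ι → R)) (ha : ∀ v, A (sa v) = a • v)
    (hb : ∀ v, A (sb v) = b • v) :
     Function.Exact A.dualMap (LinearMap.ker A).subtype.dualMap := by
  intro ψ
  constructor
  · intro hψ
    have hψ' : ∀ v, A v = 0 → ψ v = 0 := fun v hv =>
      congrArg (fun g : Module.Dual R (LinearMap.ker A) => g ⟨v, hv⟩) hψ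
    have h1 : b • (ψ ∘ₗ sa) = a • (ψ ∘ₗ sb) := by
      refine LinearMap.ext fun v => ?_
      have := hψ' (b • sa v - a • sb v) (by simp [ha, hb, smul_smul, mul_comm])
      simpa [sub_eq_zero] using this
    obtain ⟨t, ht⟩ := h.dual_two _ _ h1
    refine ⟨t, ?_⟩
    rw [← sub_eq_zero]
    apply h.dual_one
    refine LinearMap.ext fun v => ?_
    have h2 := hψ' (a • v - sa (A v)) (by simp [ha])
    have h3 := congrArg (fun g : Module.Dual R (κ → R) => g (A v)) ht
    simp only [map_sub, map_smul, smul_eq_mul, LinearMap.comp_apply, LinearMap.smul_apply] at h2 h3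
    simp only [LinearMap.smul_apply, LinearMap.sub_apply, LinearMap.dualMap_apply, smul_eq_mul,
      LinearMap.zero_apply]
    linear_combination -h3 - h2
  · rintro ⟨χ, rfl⟩
    refine LinearMap.ext fun v => ?_
    have := v.2
    simp only [LinearMap.mem_ker] at this
    simp [this]

lemma dual_surj (A : (ι → R) →ₗ[R] (κ → R)) {a b c : R} (h : RegTriple a b c)
    (sa sb sc : (κ → R) →ₗ[R] (ι → R)) (ha : ∀ v, A (sa v) = a • v)
    (hb : ∀ v, A (sb v) = b • v) (hc : ∀ v, A (sc v) = c • v) :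
     Function.Surjective (LinearMap.ker A).subtype.dualMap := by
  intro φ
  -- extension of multiples of `φ`
  let ext (x : R) (s : (κ → R) →ₗ[R] (ι → R)) (hs : ∀ v, A (s v) = x • v) :
      Module.Dual R (ι → R) :=
    φ ∘ₗ LinearMap.codRestrict (LinearMap.ker A) (x • LinearMap.id - s ∘ₗ A)
      (fun v => by simp [hs])
  let chi (x y : R) (s t : (κ → R) →ₗ[R] (ι → R)) (hs : ∀ v, A (s v) = x • v)
      (ht : ∀ v, A (t v) = y • v) : Module.Dual R (κ → R) :=
    φ ∘ₗ LinearMap.codRestrict (LinearMap.ker A) (x • t - y • s)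
      (fun v => by simp [hs, ht, smul_smul, mul_comm])
  have h0 : c • chi a b sa sb ha hb = b • chi a c sa sc ha hc + a • (-chi b c sb sc hb hc) := by
    refine LinearMap.ext fun v => ?_
    simp only [chi, LinearMap.smul_apply, LinearMap.add_apply, LinearMap.neg_apply,
      LinearMap.comp_apply, ← map_smul, ← map_add, ← map_neg]
    congr 1
    apply Subtype.ext
    simp only [LinearMap.codRestrict_apply, LinearMap.sub_apply, LinearMap.smul_apply,
      Submodule.coe_add, Submodule.coe_smul, Submodule.coe_neg, map_smul, map_neg]
    module
  obtain ⟨u, v, huv⟩ := h.dual_three _ _ _ h0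
  -- chi_ab = b u + a v
  have h1 : b • (ext a sa ha - A.dualMap u) = a • (ext b sb hb + A.dualMap v) := by
    refine LinearMap.ext fun w => ?_
    have h2 : b • ext a sa ha w - a • ext b sb hb w = chi a b sa sb ha hb (A w) := by
      simp only [ext, chi, LinearMap.comp_apply, ← map_smul, ← map_sub]
      congr 1
      apply Subtype.ext
      simp only [LinearMap.codRestrict_apply, LinearMap.sub_apply, LinearMap.smul_apply,
        Submodule.coe_sub, Submodule.coe_smul, map_smul, LinearMap.id_apply, LinearMap.comp_apply]
      module
    have h3 := congrArg (fun g : Module.Dual R (κ → R) => g (A w)) huv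
    simp only [LinearMap.smul_apply, LinearMap.sub_apply, LinearMap.add_apply,
      LinearMap.dualMap_apply, smul_eq_mul] at h2 h3 ⊢
    linear_combination h2 + h3
  obtain ⟨t, ht⟩ := h.dual_two _ _ h1
  refine ⟨t, ?_⟩
  have key : ∀ x : LinearMap.ker A, t x = φ x := by
    intro x
    rw [← sub_eq_zero]
    apply h.one
    have h4 := congrArg (fun g : Module.Dual R (ι → R) => g x) ht
    have hx : A x = 0 := x.2
    have h5 : ext a sa ha x = a • φ x := by
      simp only [ext, LinearMap.comp_apply, ← map_smul]
      congr 1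
      apply Subtype.ext
      simp [hx]
    simp only [LinearMap.smul_apply, LinearMap.sub_apply, 
      LinearMap.dualMap_apply, smul_eq_mul, hx, map_zero, sub_zero, h5] at h4
    linear_combination -h4
  exact LinearMap.ext key
end ReflPart
section CombPart
variable {R : Type} [CommRing R] {ι κ : Type} [Fintype ι] [Fintype κ] [DecidableEq ι]
  [DecidableEq κ]

lemma exists_section (A : (ι → R) →ₗ[R] (κ → R)) (a : R)
    (h : ∀ v, a • v ∈ LinearMap.range A) :
    ∃ s : (κ → R) →ₗ[R] (ι → R), ∀ v, A (s v) = a • v := by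
  choose t ht using fun k => h (Pi.basisFun R κ k)
  refine ⟨(Pi.basisFun R κ).constr R t, fun v => ?_⟩
  have : A ∘ₗ ((Pi.basisFun R κ).constr R t) = a • LinearMap.id := by
    refine (Pi.basisFun R κ).ext fun i => ?_
    rw [LinearMap.comp_apply, Module.Basis.constr_basis, ht]
    rfl
  exact congrArg (fun g : (κ → R) →ₗ[R] (κ → R) => g v) this

lemma ext_dual (A : (ι → R) →ₗ[R] (κ → R)) {a b c : R} (h : RegTriple a b c)
    (ha : ∀ v, a • v ∈ LinearMap.range A) (hb : ∀ v, b • v ∈ LinearMap.range A)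
    (hc : ∀ v, c • v ∈ LinearMap.range A)
    {D : Type} [AddCommGroup D] [Module R D] (e : D ≃ₗ[R] LinearMap.ker A) :
    Nonempty (ExtGrp R (ModuleCat.of R (Module.Dual R D)) (ModuleCat.of R R) 1 ≃ₗ[R]
      ((κ → R) ⧸ LinearMap.range A)) := by
  obtain ⟨sa, ha⟩ := exists_section A a ha
  obtain ⟨sb, hb⟩ := exists_section A b hb
  obtain ⟨sc, hc⟩ := exists_section A c hc
  have h1 := dual_inj A h sa ha
  have h2 := dual_exact A h sa sb ha hb
  have h3 := dual_surj A h sa sb sc ha hb hc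
  let E : Module.Dual R (LinearMap.ker A) ≃ₗ[R] Module.Dual R D := e.dualMap
  obtain ⟨f⟩ := ext_equiv' (Y := R) A.dualMap (E.toLinearMap ∘ₗ (LinearMap.ker A).subtype.dualMap)
    h1 (by
      intro x
      rw [← h2 x]
      simp) (E.surjective.comp h3)
  suffices hh : Nonempty ((Module.Dual R (Module.Dual R (κ → R)) ⧸
      LinearMap.range (LinearMap.lcomp R R A.dualMap)) ≃ₗ[R] ((κ → R) ⧸ LinearMap.range A)) by
    obtain ⟨g⟩ := hh
    exact ⟨f.trans g⟩
  refine ⟨?_⟩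
  refine (Submodule.Quotient.equiv _ _ (Module.evalEquiv R (κ → R)) ?_).symm
  apply le_antisymm
  · rintro _ ⟨_, ⟨y, rfl⟩, rfl⟩
    refine ⟨Module.evalEquiv R (ι → R) y, ?_⟩
    ext x
    simp
  · rintro _ ⟨y, rfl⟩
    obtain ⟨z, rfl⟩ := (Module.evalEquiv R (ι → R)).surjective y
    refine ⟨_, ⟨z, rfl⟩, ?_⟩
    ext x
    simp

end CombPart
section LengthPart
variable {K S : Type} [Field K] [CommRing S] [Algebra K S]

lemma length_eq_of_killed (𝔪 : Ideal S) (h𝔪 : ∀ s : S, ∃ c : K, s - algebraMap K S c ∈ 𝔪)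
    {M : Type} [AddCommGroup M] [Module S M] [Module K M] [IsScalarTower K S M]
    (hM : ∀ r ∈ 𝔪, ∀ x : M, r • x = 0) : Module.length S M = Module.length K M := by
  apply le_antisymm
  · rw [← WithBot.coe_le_coe, Module.coe_length, Module.coe_length]
    exact Order.krullDim_le_of_orderEmbedding (Submodule.restrictScalarsEmbedding K S M)
  let φ : Submodule K M → Submodule S M := fun N =>
    { N.toAddSubmonoid with
      smul_mem' := by
        intro s x hx
        obtain ⟨c, hc⟩ := h𝔪 s
        have h1 := hM _ hc x
        rw [sub_smul, sub_eq_zero, algebraMap_smul] at h1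
        rw [h1]
        exact N.smul_mem c hx }
  have hφ : StrictMono φ := fun a b hab => hab
  have := Order.krullDim_le_of_strictMono φ hφ
  rw [← Module.coe_length, ← Module.coe_length] at this
  exact_mod_cast this

lemma length_eq_of_nilp (𝔪 : Ideal S) (h𝔪 : ∀ s : S, ∃ c : K, s - algebraMap K S c ∈ 𝔪) (k : ℕ) :
    ∀ {M : Type} [AddCommGroup M] [Module S M] [Module K M] [IsScalarTower K S M]
    (_ : (𝔪 ^ k) • (⊤ : Submodule S M) = ⊥), Module.length S M = Module.length K M := by
  induction k with
  | zero =>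
    intro M _ _ _ _ h
    have : Subsingleton M := by
      rw [pow_zero, Ideal.one_eq_top, Submodule.top_smul] at h
      exact (Submodule.subsingleton_iff S).1 (subsingleton_of_bot_eq_top h.symm)
    simp [Module.length_eq_zero]
  | succ k ih =>
    intro M _ _ _ _ h
    let N : Submodule S M := 𝔪 • ⊤
    have hN : Module.length S N = Module.length K N := by
      apply ih
      rw [eq_bot_iff]
      have : ((𝔪 ^ k) • (⊤ : Submodule S N)).map N.subtype ≤ ⊥ := by
        rw [Submodule.map_smul'', Submodule.map_subtype_top, ← h, pow_succ, Submodule.mul_smul]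
      intro x hx
      have := this (Submodule.mem_map_of_mem hx)
      simpa using this
    have hQ : Module.length S (M ⧸ N) = Module.length K (M ⧸ N) := by
      apply length_eq_of_killed 𝔪 h𝔪
      intro r hr x
      obtain ⟨x, rfl⟩ := N.mkQ_surjective x
      rw [← map_smul, Submodule.mkQ_apply, Submodule.Quotient.mk_eq_zero]
      exact Submodule.smul_mem_smul hr trivial
    have e1 := Module.length_eq_add_of_exact N.subtype N.mkQ N.subtype_injective N.mkQ_surjective
      (LinearMap.exact_subtype_mkQ N)
    have e2 := Module.length_eq_add_of_exact (N.subtype.restrictScalars K) (N.mkQ.restrictScalars K)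
      N.subtype_injective N.mkQ_surjective (LinearMap.exact_subtype_mkQ N)
    rw [e1, e2, hN, hQ]

lemma length_step {F : Type} [AddCommGroup F] [Module S F] (N : Submodule S F) (a : S) (g : F)
    (hag : a • g ∈ N) :
    Module.length S (F ⧸ N) ≤ Module.length S (F ⧸ (N ⊔ Submodule.span S {g})) +
      Module.length S (F ⧸ (N ⊔ Ideal.span {a} • (⊤ : Submodule S F))) := by
  let φ : (F ⧸ (N ⊔ Submodule.span S {g})) →ₗ[S] (F ⧸ N) :=
    Submodule.mapQ _ _ (a • LinearMap.id) (by
      refine sup_le ?_ ?_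
      · intro x hx
        exact N.smul_mem a hx
      · rw [Submodule.span_singleton_le_iff_mem]
        exact hag)
  let π : (F ⧸ N) →ₗ[S] (F ⧸ (N ⊔ Ideal.span {a} • (⊤ : Submodule S F))) :=
    Submodule.factor le_sup_left
  have hπ : Function.Surjective π := Submodule.factor_surjective _
  have hex : Function.Exact (LinearMap.range φ).subtype π := by
    intro x
    obtain ⟨x, rfl⟩ := N.mkQ_surjective x
    have h1 : π (N.mkQ x) = (N ⊔ Ideal.span {a} • (⊤ : Submodule S F)).mkQ x := rfl
    rw [h1, Submodule.mkQ_apply, Submodule.Quotient.mk_eq_zero, Submodule.ideal_span_singleton_smul,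
      Submodule.mem_sup]
    constructor
    · rintro ⟨y, hy, z, hz, rfl⟩
      obtain ⟨w, -, rfl⟩ := hz
      refine ⟨⟨N.mkQ (y + a • w), ⟨Submodule.mkQ _ w, ?_⟩⟩, rfl⟩
      change N.mkQ (a • w) = _
      rw [map_add, (Submodule.Quotient.mk_eq_zero N (x := y)).2 hy |> fun h => (h : N.mkQ y = 0),
        zero_add]
    · rintro ⟨⟨_, ⟨w, rfl⟩⟩, hw⟩
      obtain ⟨w, rfl⟩ := Submodule.mkQ_surjective _ w
      change N.mkQ (a • w) = N.mkQ x at hw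
      rw [← sub_eq_zero, ← map_sub, Submodule.mkQ_apply, Submodule.Quotient.mk_eq_zero] at hw
      refine ⟨x - a • w, ?_, a • w, ⟨w, trivial, rfl⟩, by abel⟩
      rw [← neg_mem_iff, neg_sub]
      exact hw
  rw [Module.length_eq_add_of_exact _ π (LinearMap.range φ).subtype_injective hπ hex]
  gcongr
  exact Module.length_le_of_surjective φ.rangeRestrict φ.surjective_rangeRestrict

lemma nilp_step {F : Type} [AddCommGroup F] [Module S F] (N : Submodule S F) (a : S) (g : F)
    (hag : a • g ∈ N) (𝔪 : Ideal S) (k k' : ℕ)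
    (h1 : 𝔪 ^ k • ⊤ ≤ N ⊔ Ideal.span {a} • (⊤ : Submodule S F))
    (h2 : 𝔪 ^ k' • ⊤ ≤ N ⊔ Submodule.span S {g}) : 𝔪 ^ (k' + k) • ⊤ ≤ N := by
  rw [pow_add, Submodule.mul_smul]
  refine (Submodule.smul_mono le_rfl h1).trans ?_
  rw [Submodule.smul_sup]
  refine sup_le Submodule.smul_le_right ?_
  rw [← Submodule.mul_smul, mul_comm, Submodule.mul_smul]
  refine (Submodule.smul_mono le_rfl h2).trans ?_
  rw [Submodule.smul_sup]
  refine sup_le Submodule.smul_le_right ?_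
  rw [Submodule.ideal_span_singleton_smul]
  rintro _ ⟨x, hx, rfl⟩
  obtain ⟨t, rfl⟩ := Submodule.mem_span_singleton.1 hx
  change a • t • g ∈ N
  rw [smul_comm]
  exact N.smul_mem t hag

variable {ι F : Type} [Fintype ι] [DecidableEq ι] [AddCommGroup F] [Module S F]

/-- The relation submodule with hyperplanes of `B` contracted, those in `C` deleted. -/
def relN (α : ι → S) (g : ι → F) (B C : Finset ι) : Submodule S F :=
  Submodule.span S (Set.range fun i => α i • g i) ⊔ Submodule.span S (g '' C) ⊔
    Ideal.span (α '' B) • ⊤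

lemma relN_insert_right (α : ι → S) (g : ι → F) (B C : Finset ι) (j : ι) :
    relN α g B (insert j C) = relN α g B C ⊔ Submodule.span S {g j} := by
  unfold relN
  rw [Finset.coe_insert, Set.image_insert_eq, Submodule.span_insert]
  ac_rfl

lemma relN_insert_left (α : ι → S) (g : ι → F) (B C : Finset ι) (j : ι) :
    relN α g (insert j B) C = relN α g B C ⊔ Ideal.span {α j} • (⊤ : Submodule S F) := by
  unfold relN
  rw [Finset.coe_insert, Set.image_insert_eq, Ideal.span_insert, Submodule.sup_smul]
  conv_lhs => rw [sup_comm (Ideal.span {α j} • (⊤ : Submodule S F))]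
  rw [sup_assoc _ _ (Ideal.span {α j} • (⊤ : Submodule S F))]

lemma smul_mem_relN (α : ι → S) (g : ι → F) (B C : Finset ι) (j : ι) :
    α j • g j ∈ relN α g B C :=
  Submodule.mem_sup_left (Submodule.mem_sup_left (Submodule.subset_span ⟨j, rfl⟩))

lemma relN_base (α : ι → S) (g : ι → F) (𝔪 : Ideal S) (l m : ℕ)
    (hcard : Fintype.card ι = m + l)
    (hα : ∀ B : Finset ι, B.card = l → 𝔪 ≤ Ideal.span (α '' B))
    (hg : ∀ T : Finset ι, T.card = m → Submodule.span S (g '' T) = ⊤)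
    (B C : Finset ι) (hB : B.card + 1 = l) : 𝔪 • ⊤ ≤ relN α g B C := by
  obtain ⟨T, hT, hTm⟩ : ∃ T ⊆ Bᶜ, T.card = m := by
    apply Finset.exists_subset_card_eq
    rw [Finset.card_compl]; omega
  rw [← hg T hTm, Submodule.smul_le]
  intro r hr x hx
  induction hx using Submodule.span_induction with
  | mem x hx =>
    obtain ⟨j, hj, rfl⟩ := hx
    have hjB : j ∉ B := Finset.mem_compl.1 (hT hj)
    have h1 := hα (insert j B) (by rw [Finset.card_insert_of_notMem hjB]; exact hB) hr
    rw [Finset.coe_insert, Set.image_insert_eq, Ideal.mem_span_insert] at h1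
    obtain ⟨t, z, hz, rfl⟩ := h1
    rw [add_smul, mul_smul]
    refine add_mem (Submodule.smul_mem _ _ (smul_mem_relN α g B C j)) ?_
    exact Submodule.mem_sup_right (Submodule.smul_mem_smul hz trivial)
  | zero => simp
  | add x y _ _ hx hy => rw [smul_add]; exact add_mem hx hy
  | smul a x _ hx => rw [smul_comm]; exact Submodule.smul_mem _ _ hx

lemma relN_base_length (α : ι → S) (g : ι → F) (𝔪 : Ideal S)
    (h𝔪 : ∀ s : S, ∃ c : K, s - algebraMap K S c ∈ 𝔪) (l m : ℕ)
    (hcard : Fintype.card ι = m + l)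
    (hα : ∀ B : Finset ι, B.card = l → 𝔪 ≤ Ideal.span (α '' B))
    (hg : ∀ T : Finset ι, T.card = m → Submodule.span S (g '' T) = ⊤)
    (B C : Finset ι) (hB : B.card + 1 = l) (p : ℕ) (hC : C.card + p = m) :
    Module.length S (F ⧸ relN α g B C) ≤ p := by
  classical
  have hk := relN_base α g 𝔪 l m hcard hα hg B C hB
  let : Module K F := Module.compHom F (algebraMap K S)
  have : IsScalarTower K S F := IsScalarTower.of_algebraMap_smul fun _ _ => rfl
  have hkill : ∀ r ∈ 𝔪, ∀ x : F ⧸ relN α g B C, r • x = 0 := by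
    intro r hr x
    obtain ⟨x, rfl⟩ := Submodule.mkQ_surjective _ x
    rw [← map_smul, Submodule.mkQ_apply, Submodule.Quotient.mk_eq_zero]
    exact hk (Submodule.smul_mem_smul hr trivial)
  rw [length_eq_of_killed (K := K) 𝔪 h𝔪 hkill]
  obtain ⟨T, hT, hTp⟩ : ∃ T ⊆ Cᶜ, T.card = p := by
    apply Finset.exists_subset_card_eq
    rw [Finset.card_compl]; omega
  have hspan : Submodule.span S (g '' (C ∪ T : Finset ι)) = ⊤ := by
    apply hg
    rw [Finset.card_union_of_disjoint, hTp, hC]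
    exact (Finset.subset_compl_iff_disjoint_left).1 hT
  let q := (relN α g B C).mkQ
  have hfin : Submodule.span K ((T.image fun j => q (g j) : Finset _) : Set (F ⧸ relN α g B C)) = ⊤ := by
    rw [eq_top_iff]
    rintro x -
    obtain ⟨x, rfl⟩ := Submodule.mkQ_surjective _ x
    have hx : x ∈ Submodule.span S (g '' (C ∪ T : Finset ι)) := hspan ▸ trivial
    induction hx using Submodule.span_induction with
    | mem x hx =>
      obtain ⟨j, hj, rfl⟩ := hx
      rcases Finset.mem_union.1 hj with hj | hj
      · have : q (g j) = 0 := by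
          rw [Submodule.mkQ_apply, Submodule.Quotient.mk_eq_zero]
          exact Submodule.mem_sup_left (Submodule.mem_sup_right (Submodule.subset_span ⟨j, hj, rfl⟩))
        change q (g j) ∈ _
        rw [this]; exact zero_mem _
      · exact Submodule.subset_span (Finset.mem_coe.2 (Finset.mem_image_of_mem _ hj))
    | zero => simp
    | add x y _ _ hx hy => rw [map_add]; exact add_mem hx hy
    | smul a x _ hx =>
      obtain ⟨c, hc⟩ := h𝔪 a
      have h1 := hkill _ hc (q x)
      rw [sub_smul, sub_eq_zero, algebraMap_smul] at h1
      change q (a • x) ∈ _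
      rw [map_smul, h1]
      exact Submodule.smul_mem _ _ hx
  have : Module.Finite K (F ⧸ relN α g B C) := ⟨⟨_, hfin⟩⟩
  rw [Module.length_eq_finrank]
  have h2 := finrank_span_finset_le_card (R := K) (T.image fun j => q (g j))
  rw [Set.finrank, hfin, finrank_top] at h2
  exact_mod_cast h2.trans (Finset.card_image_le.trans hTp.le)

lemma relN_main (α : ι → S) (g : ι → F) (𝔪 : Ideal S)
    (h𝔪 : ∀ s : S, ∃ c : K, s - algebraMap K S c ∈ 𝔪) (l m : ℕ)
    (hcard : Fintype.card ι = m + l)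
    (hα : ∀ B : Finset ι, B.card = l → 𝔪 ≤ Ideal.span (α '' B))
    (hg : ∀ T : Finset ι, T.card = m → Submodule.span S (g '' T) = ⊤)
    (q : ℕ) : ∀ (p : ℕ) (B C : Finset ι) (_ : Disjoint B C) (_ : B.card + (q + 1) = l)
      (_ : C.card + p = m),
    (∃ k, 𝔪 ^ k • ⊤ ≤ relN α g B C) ∧
      Module.length S (F ⧸ relN α g B C) ≤ ((p + q).choose (q + 1) : ℕ) := by
  induction q with
  | zero =>
    intro p B C hd hB hC
    refine ⟨⟨1, ?_⟩, ?_⟩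
    · rw [pow_one]; exact relN_base α g 𝔪 l m hcard hα hg B C hB
    · simpa using relN_base_length α g 𝔪 h𝔪 l m hcard hα hg B C hB p hC
  | succ q ihq =>
    intro p
    induction p with
    | zero =>
      intro B C hd hB hC
      have htop : relN α g B C = ⊤ := by
        rw [eq_top_iff, ← hg C hC]
        exact le_sup_of_le_left le_sup_right
      refine ⟨⟨0, ?_⟩, ?_⟩
      · rw [htop]; exact le_top
      · rw [htop]
        have : Subsingleton (F ⧸ (⊤ : Submodule S F)) := Submodule.Quotient.subsingleton_iff.2 rfl
        simp [Module.length_eq_zero]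
    | succ p ihp =>
      intro B C hd hB hC
      obtain ⟨j, hj⟩ : ∃ j, j ∉ B ∪ C := by
        by_contra! hcon
        have h1 : (B ∪ C) = Finset.univ := Finset.eq_univ_iff_forall.2 hcon
        have h2 := Finset.card_union_of_disjoint hd
        rw [h1, Finset.card_univ] at h2
        omega
      rw [Finset.mem_union, not_or] at hj
      obtain ⟨⟨k', hk'⟩, hl'⟩ := ihp B (insert j C)
        (by rw [Finset.disjoint_insert_right]; exact ⟨hj.1, hd⟩) hB
        (by rw [Finset.card_insert_of_notMem hj.2]; omega)
      obtain ⟨⟨k, hk⟩, hl⟩ := ihq (p + 1) (insert j B) C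
        (by rw [Finset.disjoint_insert_left]; exact ⟨hj.2, hd⟩)
        (by rw [Finset.card_insert_of_notMem hj.1]; omega) hC
      rw [relN_insert_right] at hk' hl'
      rw [relN_insert_left] at hk hl
      have hm := smul_mem_relN α g B C j
      refine ⟨⟨k' + k, nilp_step _ _ _ hm 𝔪 k k' hk hk'⟩, ?_⟩
      refine (length_step _ _ _ hm).trans ((add_le_add hl' hl).trans ?_)
      have e : (p + 1 + (q + 1)).choose (q + 1 + 1) =
          (p + (q + 1)).choose (q + 1 + 1) + (p + 1 + q).choose (q + 1) := by
        have : p + 1 + (q + 1) = (p + 1 + q) + 1 := by ring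
        rw [this, Nat.choose_succ_succ, show p + (q + 1) = p + 1 + q by ring, add_comm]
      rw [e]
      push_cast
      rfl

end LengthPart
section LinAlg
variable {K : Type} [Field K]

lemma exists_matrices {l n m : ℕ} (hnm : n = m + l) (a : Matrix (Fin n) (Fin l) K)
    (ha : ∀ v, a.mulVec v = 0 → v = 0) :
    ∃ (c : Matrix (Fin m) (Fin n) K) (s : Matrix (Fin n) (Fin m) K) (p : Matrix (Fin l) (Fin n) K),
      c * a = 0 ∧ c * s = 1 ∧ a * p + s * c = 1 := by
  classical
  let f := Matrix.toLin' a
  have hf : Function.Injective f := by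
    rw [injective_iff_map_eq_zero]
    exact ha
  have h1 : Module.finrank K ((Fin n → K) ⧸ LinearMap.range f) = m := by
    have := Submodule.finrank_quotient_add_finrank (LinearMap.range f)
    rw [LinearMap.finrank_range_of_inj hf] at this
    simp only [Module.finrank_fin_fun] at this
    omega
  let e : ((Fin n → K) ⧸ LinearMap.range f) ≃ₗ[K] (Fin m → K) :=
    LinearEquiv.ofFinrankEq _ _ (by rw [h1]; simp)
  let c : (Fin n → K) →ₗ[K] (Fin m → K) := e.toLinearMap.comp (LinearMap.range f).mkQ
  have hcsurj : Function.Surjective c := e.surjective.comp (Submodule.mkQ_surjective _)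
  have hker : LinearMap.ker c = LinearMap.range f := by
    rw [LinearMap.ker_comp, LinearEquiv.ker, ← LinearMap.ker, Submodule.ker_mkQ]
  obtain ⟨s, hs⟩ := LinearMap.exists_rightInverse_of_surjective c (LinearMap.range_eq_top.2 hcsurj)
  let r : (Fin n → K) →ₗ[K] LinearMap.range f :=
    (LinearMap.id - s.comp c).codRestrict (LinearMap.range f) (by
      intro w
      rw [← hker, LinearMap.mem_ker, LinearMap.sub_apply, map_sub, LinearMap.id_apply,
        sub_eq_zero]
      exact (LinearMap.congr_fun hs (c w)).symm)
  let p : (Fin n → K) →ₗ[K] (Fin l → K) := (LinearEquiv.ofInjective f hf).symm.toLinearMap.comp r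
  have hp : f.comp p + s.comp c = LinearMap.id := by
    ext1 w
    ext1
    simp only [LinearMap.comp_apply, LinearMap.add_apply, p]
    have : f ((LinearEquiv.ofInjective f hf).symm (r (LinearMap.single K (fun _ => K) w 1))) = r (LinearMap.single K (fun _ => K) w 1) := by
      have := LinearEquiv.apply_symm_apply (LinearEquiv.ofInjective f hf) (r (LinearMap.single K (fun _ => K) w 1))
      rw [Subtype.ext_iff, LinearEquiv.ofInjective_apply] at this
      exact this
    change (f ((LinearEquiv.ofInjective f hf).symm (r (LinearMap.single K (fun _ => K) w 1))) + _) = _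
    rw [this]
    simp [r]
  have hfa : LinearMap.toMatrix' f = a := LinearMap.toMatrix'_toLin' a
  refine ⟨LinearMap.toMatrix' c, LinearMap.toMatrix' s, LinearMap.toMatrix' p, ?_, ?_, ?_⟩
  · rw [← hfa, ← LinearMap.toMatrix'_comp]
    have : c.comp f = 0 := by
      ext1 w
      apply LinearMap.ext
      intro t
      have : f (LinearMap.single K (fun _ => K) w t) ∈ LinearMap.ker c := hker ▸ ⟨_, rfl⟩
      exact this
    rw [this, map_zero]
  · rw [← LinearMap.toMatrix'_comp, hs, LinearMap.toMatrix'_id]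
  · rw [← hfa, ← LinearMap.toMatrix'_comp, ← LinearMap.toMatrix'_comp, ← map_add, hp,
      LinearMap.toMatrix'_id]

lemma exists_inv {k : ℕ} (M : Matrix (Fin k) (Fin k) K) (h : ∀ y, Matrix.vecMul y M = 0 → y = 0) :
    ∃ N, N * M = 1 ∧ M * N = 1 := by
  have : Function.Injective M.vecMul := by
    intro x y hxy
    rw [← sub_eq_zero]
    apply h
    rw [Matrix.sub_vecMul, sub_eq_zero]
    exact hxy
  obtain ⟨u, hu⟩ := Matrix.vecMul_injective_iff_isUnit.1 this
  exact ⟨((u⁻¹ : (Matrix (Fin k) (Fin k) K)ˣ) : Matrix (Fin k) (Fin k) K), by rw [← hu]; simp, by rw [← hu]; simp⟩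

end LinAlg
section ArrPart
open MvPolynomial

/-- Linear algebra data attached to a generic arrangement. -/
structure Arr (K : Type) [Field K] (l m n : ℕ) where
  a : Matrix (Fin n) (Fin l) K
  c : Matrix (Fin m) (Fin n) K
  s : Matrix (Fin n) (Fin m) K
  p : Matrix (Fin l) (Fin n) K
  ca : c * a = 0
  cs : c * s = 1
  pa : p * a = 1
  apsc : a * p + s * c = 1
  hn : n = m + l
  gen : ∀ (B : Finset (Fin n)) (r : Fin n → K), B.card = l → (∀ i, i ∉ B → r i = 0) →
    Matrix.vecMul r a = 0 → r = 0

variable {K : Type} [Field K] {l m n : ℕ} (D : Arr K l m n)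

namespace Arr

noncomputable def α (i : Fin n) : MvPolynomial (Fin l) K := ∑ k, C (D.a i k) * X k

noncomputable def g (i : Fin n) : Fin m → MvPolynomial (Fin l) K := fun k => C (D.c k i)

noncomputable def A : (Fin n → MvPolynomial (Fin l) K) →ₗ[MvPolynomial (Fin l) K]
    (Fin m → MvPolynomial (Fin l) K) :=
  ∑ i, (LinearMap.toSpanSingleton _ _ (D.α i • D.g i)).comp (LinearMap.proj i)

lemma A_apply (h : Fin n → MvPolynomial (Fin l) K) : D.A h = ∑ i, h i • D.α i • D.g i := by
  simp [A]

lemma A_apply' (h : Fin n → MvPolynomial (Fin l) K) (k : Fin m) :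
    D.A h k = ∑ i, C (D.c k i) * (D.α i * h i) := by
  rw [A_apply, Finset.sum_apply]
  refine Finset.sum_congr rfl fun i _ => ?_
  simp [g]; ring

lemma range_A : LinearMap.range D.A = relN D.α D.g ∅ ∅ := by
  have h1 : relN D.α D.g ∅ ∅ = Submodule.span _ (Set.range fun i => D.α i • D.g i) := by
    simp [relN]
  rw [h1]
  apply le_antisymm
  · rintro _ ⟨h, rfl⟩
    rw [A_apply]
    exact sum_mem fun i _ => Submodule.smul_mem _ _ (Submodule.subset_span ⟨i, rfl⟩)
  · rw [Submodule.span_le]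
    rintro _ ⟨i, rfl⟩
    refine ⟨Pi.single i 1, ?_⟩
    rw [A_apply, Finset.sum_eq_single i]
    · simp
    · intro j _ hj; simp [hj]
    · simp

lemma sum_zero : ∑ i, D.α i • D.g i = 0 := by
  ext1 k
  rw [Finset.sum_apply]
  simp only [α, g, Pi.smul_apply, smul_eq_mul, Finset.sum_mul, Pi.zero_apply]
  rw [Finset.sum_comm]
  refine Finset.sum_eq_zero fun j _ => ?_
  have := congrFun (congrFun D.ca k) j
  rw [Matrix.mul_apply, Matrix.zero_apply] at this
  calc _ = (C (∑ i, D.c k i * D.a i j)) * X j := by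
        rw [map_sum, Finset.sum_mul]
        refine Finset.sum_congr rfl fun i _ => ?_
        rw [C_mul]; ring
    _ = 0 := by rw [this]; simp

lemma hα (B : Finset (Fin n)) (hB : B.card = l) :
    Ideal.span (Set.range (X : Fin l → MvPolynomial (Fin l) K)) ≤ Ideal.span (D.α '' B) := by
  let e : Fin l ≃ B := (Fintype.equivFinOfCardEq (by simpa using hB)).symm
  let M : Matrix (Fin l) (Fin l) K := Matrix.of fun i k => D.a (e i) k
  obtain ⟨N, hN, -⟩ := exists_inv M (by
    intro y hy
    let r : Fin n → K := fun i => if h : i ∈ B then y (e.symm ⟨i, h⟩) else 0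
    have hr : r = 0 := by
      apply D.gen B r hB
      · intro i hi; simp [r, hi]
      · ext k
        rw [← hy]
        simp only [Matrix.vecMul, dotProduct, M, Matrix.of_apply]
        rw [← Finset.sum_subset (Finset.subset_univ B), ← Finset.sum_attach]
        · refine (Finset.sum_equiv e ?_ ?_).symm
          · simp
          · intro i _
            simp [r]
        · intro i _ hi; simp [r, hi]
    ext i
    have := congrFun hr (e i)
    simpa [r] using this)
  rw [Ideal.span_le]
  rintro _ ⟨k, rfl⟩
  have : (X k : MvPolynomial (Fin l) K) = ∑ j, C (N k j) * D.α (e j) := by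
    simp only [α, Finset.mul_sum]
    rw [Finset.sum_comm]
    have h1 : ∀ i, ∑ j, C (N k j) * (C (D.a (e j) i) * X i) =
        C ((1 : Matrix (Fin l) (Fin l) K) k i) * (X i : MvPolynomial (Fin l) K) := by
      intro i
      rw [← hN, Matrix.mul_apply, map_sum, Finset.sum_mul]
      refine Finset.sum_congr rfl fun j _ => ?_
      simp [M]; ring
    simp only [h1]
    rw [Finset.sum_eq_single k]
    · simp
    · intro i _ hi; simp [Matrix.one_apply_ne (Ne.symm hi)]
    · simp
  rw [this]
  exact sum_mem fun j _ => Ideal.mul_mem_left _ _ (Ideal.subset_span ⟨e j, (e j).2, rfl⟩)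

lemma hg (T : Finset (Fin n)) (hT : T.card = m) :
    Submodule.span (MvPolynomial (Fin l) K) (D.g '' T) = ⊤ := by
  let e : Fin m ≃ T := (Fintype.equivFinOfCardEq (by simpa using hT)).symm
  let M : Matrix (Fin m) (Fin m) K := Matrix.of fun k i => D.c k (e i)
  obtain ⟨N, -, hN⟩ := exists_inv M (by
    intro y hy
    have hr : Matrix.vecMul y D.c = 0 := by
      apply D.gen Tᶜ
      · have := D.hn
        rw [Finset.card_compl, Fintype.card_fin]; omega
      · intro i hi
        rw [Finset.mem_compl, not_not] at hi
        have := congrFun hy (e.symm ⟨i, hi⟩)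
        simpa [Matrix.vecMul, dotProduct, M] using this
      · rw [Matrix.vecMul_vecMul, D.ca, Matrix.vecMul_zero]
    rw [← Matrix.vecMul_one y, ← D.cs, ← Matrix.vecMul_vecMul, hr, Matrix.zero_vecMul])
  rw [eq_top_iff]
  rintro v -
  have : v = ∑ j, (∑ k, C (N j k) * v k) • D.g (e j) := by
    ext1 i
    simp only [Finset.sum_apply, Pi.smul_apply, g, smul_eq_mul, Finset.sum_mul]
    rw [Finset.sum_comm]
    have h1 : ∀ k, ∑ j, C (N j k) * v k * C (D.c i (e j)) =
        C ((1 : Matrix (Fin m) (Fin m) K) i k) * v k := by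
      intro k
      rw [← hN, Matrix.mul_apply, map_sum, Finset.sum_mul]
      refine Finset.sum_congr rfl fun j _ => ?_
      simp [M]; ring
    simp only [h1]
    rw [Finset.sum_eq_single i]
    · simp
    · intro k _ hi; simp [Matrix.one_apply_ne (Ne.symm hi)]
    · simp
  rw [this]
  exact sum_mem fun j _ => Submodule.smul_mem _ _ (Submodule.subset_span ⟨e j, (e j).2, rfl⟩)

lemma h𝔪 (s : MvPolynomial (Fin l) K) : ∃ c : K, s - algebraMap K _ c ∈
    Ideal.span (Set.range (X : Fin l → MvPolynomial (Fin l) K)) := by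
  refine ⟨constantCoeff s, ?_⟩
  have : Set.range (X : Fin l → MvPolynomial (Fin l) K) = X '' Set.univ := by simp
  rw [this, mem_ideal_span_X_image]
  intro d hd
  by_contra! h
  have : d = 0 := by ext i; simpa using h i
  subst this
  rw [mem_support_iff] at hd
  apply hd
  simp [algebraMap_eq, constantCoeff_eq]

lemma upper (hl : 1 ≤ l) :
    (∃ k, Ideal.span (Set.range (X : Fin l → MvPolynomial (Fin l) K)) ^ k • ⊤ ≤ LinearMap.range D.A) ∧
    Module.length (MvPolynomial (Fin l) K) ((Fin m → MvPolynomial (Fin l) K) ⧸ LinearMap.range D.A) ≤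
      ((n - 1).choose l : ℕ) := by
  obtain ⟨q, rfl⟩ : ∃ q, l = q + 1 := ⟨l - 1, by omega⟩
  have := relN_main (K := K) D.α D.g _ h𝔪 (q + 1) m (by rw [Fintype.card_fin]; exact D.hn) D.hα D.hg q m ∅ ∅
    (by simp) (by simp) (by simp)
  rw [← range_A] at this
  have hn := D.hn
  rw [show n - 1 = m + q by omega]
  exact this

end Arr
end ArrPart
section RegPart
open MvPolynomial
variable {K : Type} [Field K] {σ : Type}

lemma pow_pair_mem (i j : σ) (N : ℕ) (r : MvPolynomial σ K) :
    r ∈ Ideal.span {(X i : MvPolynomial σ K) ^ N, (X j : MvPolynomial σ K) ^ N} ↔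
    ∀ d ∈ r.support, Finsupp.single i N ≤ d ∨ Finsupp.single j N ≤ d := by
  have : ({(X i : MvPolynomial σ K) ^ N, (X j : MvPolynomial σ K) ^ N} : Set (MvPolynomial σ K)) =
      (fun s => monomial s (1 : K)) '' {Finsupp.single i N, Finsupp.single j N} := by
    rw [Set.image_pair, X_pow_eq_monomial, X_pow_eq_monomial]
  rw [this, mem_ideal_span_monomial_image]
  simp

lemma regTriple_X {i j k : σ} (hij : i ≠ j) (hik : i ≠ k) (hjk : j ≠ k) (N : ℕ) :
    RegTriple ((X i : MvPolynomial σ K) ^ N) (X j ^ N) (X k ^ N) where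
  one r h := by
    rcases mul_eq_zero.1 h with h | h
    · exact absurd h (pow_ne_zero _ (X_ne_zero i))
    · exact h
  two r s h := by
    have hp : Prime (X i : MvPolynomial σ K) := X_prime
    obtain ⟨t, ht⟩ := hp.pow_dvd_of_dvd_mul_left N (a := X j ^ N) (b := r) (by
      intro hd
      exact hij (X_dvd_X.1 (hp.dvd_of_dvd_pow hd))) ⟨s, h⟩
    exact ⟨t, ht⟩
  three r s t h := by
    have h1 : X k ^ N * r ∈ Ideal.span {(X j : MvPolynomial σ K) ^ N, (X i : MvPolynomial σ K) ^ N} := by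
      rw [Ideal.mem_span_pair]
      exact ⟨s, t, by rw [h]; ring⟩
    rw [pow_pair_mem] at h1
    have h2 : r ∈ Ideal.span {(X j : MvPolynomial σ K) ^ N, (X i : MvPolynomial σ K) ^ N} := by
      rw [pow_pair_mem]
      intro d hd
      have hc : coeff (Finsupp.single k N + d) (X k ^ N * r) = coeff d r := by
        rw [X_pow_eq_monomial, coeff_monomial_mul, one_mul]
      have h3 := h1 (Finsupp.single k N + d) (by
        rw [mem_support_iff, hc]; exact mem_support_iff.1 hd)
      simp only [Finsupp.single_le_iff, Finsupp.add_apply] at h3 ⊢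
      rw [Finsupp.single_eq_of_ne hjk, Finsupp.single_eq_of_ne hik] at h3
      simpa using h3
    obtain ⟨u, v, huv⟩ := Ideal.mem_span_pair.1 h2
    exact ⟨u, v, by rw [← huv]; ring⟩

lemma derivation_prod {R A : Type} [CommRing R] [CommRing A] [Algebra R A] (d : Derivation R A A)
    {ι : Type} [DecidableEq ι] (s : Finset ι) (f : ι → A) :
    d (∏ i ∈ s, f i) = ∑ i ∈ s, (∏ j ∈ s.erase i, f j) * d (f i) := by
  induction s using Finset.induction_on with
  | empty => simp
  | insert j s hj ih =>
    rw [Finset.prod_insert hj, Derivation.leibniz, ih, Finset.sum_insert hj, Finset.erase_insert hj,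
      smul_eq_mul, smul_eq_mul, add_comm, Finset.mul_sum]
    congr 1
    refine Finset.sum_congr rfl fun i hi => ?_
    have hij : i ≠ j := fun h => hj (h ▸ hi)
    rw [Finset.erase_insert_of_ne hij.symm, Finset.prod_insert (fun h => hj (Finset.mem_of_mem_erase h)), mul_assoc]

variable {l m n : ℕ} (D : Arr K l m n)

namespace Arr

lemma gen_two (hl : 2 ≤ l) (i j : Fin n) (u : K) (h : ∀ k, D.a j k = u * D.a i k) : i = j := by
  by_contra hij
  have hn := D.hn
  obtain ⟨B, hB, -, hBl⟩ : ∃ B, {i, j} ⊆ B ∧ B ⊆ Finset.univ ∧ B.card = l := by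
    apply Finset.exists_subsuperset_card_eq (Finset.subset_univ _)
    · exact (Finset.card_le_two).trans hl
    · rw [Finset.card_univ, Fintype.card_fin]; omega
  have := D.gen B (Pi.single j 1 - u • Pi.single i 1) hBl (by
    intro t ht
    have h1 : t ≠ i := fun h => ht (hB (by simp [h]))
    have h2 : t ≠ j := fun h => ht (hB (by simp [h]))
    simp [h1, h2]) (by
    ext k
    rw [Matrix.sub_vecMul, Matrix.smul_vecMul]
    simp [h k])
  have := congrFun this j
  simp [Ne.symm hij] at this

lemma pderiv_α (i : Fin n) (k : Fin l) : pderiv k (D.α i) = C (D.a i k) := by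
  rw [α, map_sum, Finset.sum_eq_single k]
  · rw [pderiv_C_mul, pderiv_X_self, mul_one]
  · intro j _ hj
    rw [pderiv_C_mul, pderiv_X_of_ne hj, mul_zero]
  · simp

lemma α_homog (i : Fin n) : (D.α i).IsHomogeneous 1 :=
  IsHomogeneous.sum _ _ _ fun k _ => by
    simpa using (isHomogeneous_C (Fin l) (D.a i k)).mul (isHomogeneous_X K k)

lemma α_ne_zero (hl : 1 ≤ l) (i : Fin n) : D.α i ≠ 0 := by
  intro h0
  have hn := D.hn
  obtain ⟨B, hB, -, hBl⟩ : ∃ B, {i} ⊆ B ∧ B ⊆ Finset.univ ∧ B.card = l := by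
    apply Finset.exists_subsuperset_card_eq (Finset.subset_univ _)
    · simpa using hl
    · rw [Finset.card_univ, Fintype.card_fin]; omega
  have := D.gen B (Pi.single i 1) hBl (by
    intro t ht
    have h1 : t ≠ i := fun h => ht (hB (by simp [h]))
    simp [h1]) (by
    ext k
    have := D.pderiv_α i k
    rw [h0, map_zero] at this
    have := C_injective _ _ ((map_zero C).trans this)
    simp [← this])
  have := congrFun this i
  simp at this

lemma α_prime (hl : 1 ≤ l) (i : Fin n) : Prime (D.α i) := by
  rw [← UniqueFactorizationMonoid.irreducible_iff_prime]
  refine irreducible_of_totalDegree_eq_one ((D.α_homog i).totalDegree (D.α_ne_zero hl i)) ?_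
  intro x hx
  rw [isUnit_iff_ne_zero]
  rintro rfl
  apply D.α_ne_zero hl i
  ext d
  simpa using hx d

lemma α_not_dvd (hl : 2 ≤ l) (i j : Fin n) (hij : i ≠ j) : ¬ D.α i ∣ D.α j := by
  rintro ⟨u, hu⟩
  apply hij
  apply D.gen_two hl i j (constantCoeff u)
  intro k
  have h1 : constantCoeff (D.α i) = 0 := by simp [α]
  have := congrArg (fun p => constantCoeff (pderiv k p)) hu
  simpa [pderiv_mul, pderiv_α, h1, mul_comm] using this

noncomputable def L (θ : Fin l → MvPolynomial (Fin l) K) (i : Fin n) : MvPolynomial (Fin l) K :=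
  ∑ k, C (D.a i k) * θ k

lemma mem_Dlog (hl : 2 ≤ l) (θ : Fin l → MvPolynomial (Fin l) K) :
    θ ∈ Dlog K l (∏ i, D.α i) ↔ ∀ i, D.α i ∣ D.L θ i := by
  have h1 : θ ∈ Dlog K l (∏ i, D.α i) ↔ (∏ i, D.α i) ∣
      ∑ i, (∏ j ∈ Finset.univ.erase i, D.α j) * D.L θ i := by
    rw [Dlog, Submodule.mem_comap, Ideal.mem_span_singleton]
    have : ∑ i, (∏ j ∈ Finset.univ.erase i, D.α j) * D.L θ i =
      ∑ k, θ k * pderiv k (∏ i, D.α i) := by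
      simp only [derivation_prod, L, Finset.mul_sum, pderiv_α]
      rw [Finset.sum_comm]
      refine Finset.sum_congr rfl fun k _ => Finset.sum_congr rfl fun i _ => ?_
      ring
    rw [this]
    simp
  rw [h1]
  constructor
  · intro h i
    have h2 := (Finset.dvd_prod_of_mem D.α (Finset.mem_univ i)).trans h
    rw [← Finset.add_sum_erase _ _ (Finset.mem_univ i), dvd_add_left] at h2
    · refine ((D.α_prime (by omega) i).dvd_or_dvd h2).resolve_left ?_
      rw [(D.α_prime (by omega) i).dvd_finset_prod_iff]
      rintro ⟨j, hj, hd⟩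
      exact D.α_not_dvd hl i j (Finset.ne_of_mem_erase hj).symm hd
    · refine Finset.dvd_sum fun j hj => Dvd.dvd.mul_right (Finset.dvd_prod_of_mem _ ?_) _
      exact Finset.mem_erase.2 ⟨(Finset.ne_of_mem_erase hj).symm, Finset.mem_univ _⟩
  · intro h
    refine Finset.dvd_sum fun i _ => ?_
    rw [← Finset.prod_erase_mul _ _ (Finset.mem_univ i)]
    exact mul_dvd_mul_left _ (h i)

/-- The map from the kernel of `A` to derivations. -/
noncomputable def P : (Fin n → MvPolynomial (Fin l) K) →ₗ[MvPolynomial (Fin l) K]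
    (Fin l → MvPolynomial (Fin l) K) :=
  LinearMap.pi fun k => ∑ i, (C (D.p k i) * D.α i) • LinearMap.proj i

lemma P_apply (h) (k) : D.P h k = ∑ i, C (D.p k i) * (D.α i * h i) := by
  simp [P, mul_assoc]

lemma P_eq (h) : D.P h = Matrix.mulVec (D.p.map C) (fun i => D.α i * h i) := by
  ext1 k
  rw [P_apply]
  rfl

lemma A_eq (h) : D.A h = Matrix.mulVec (D.c.map C) (fun i => D.α i * h i) := by
  ext1 k
  rw [A_apply']
  rfl

lemma L_eq (θ) : D.L θ = Matrix.mulVec (D.a.map C) θ := rfl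

lemma L_P (h) (hh : D.A h = 0) : D.L (D.P h) = fun i => D.α i * h i := by
  rw [L_eq, P_eq, Matrix.mulVec_mulVec]
  have h1 := congrArg (fun M => M.map (C : K →+* MvPolynomial (Fin l) K)) D.apsc
  simp only [Matrix.map_add _ (map_add (C : K →+* MvPolynomial (Fin l) K)), Matrix.map_mul,
    Matrix.map_one _ (map_zero (C : K →+* MvPolynomial (Fin l) K)) (map_one _)] at h1
  have h2 := congrArg (fun M => Matrix.mulVec M (fun i => D.α i * h i)) h1
  simp only [Matrix.add_mulVec, ← Matrix.mulVec_mulVec, Matrix.one_mulVec] at h2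
  rw [← A_eq, hh, Matrix.mulVec_zero, add_zero] at h2
  rw [← Matrix.mulVec_mulVec]
  exact h2

lemma equivD (hl : 2 ≤ l) : Nonempty (Dlog K l (∏ i, D.α i) ≃ₗ[MvPolynomial (Fin l) K]
    LinearMap.ker D.A) := by
  let φ : LinearMap.ker D.A →ₗ[MvPolynomial (Fin l) K] Dlog K l (∏ i, D.α i) :=
    LinearMap.codRestrict _ (D.P.comp (LinearMap.ker D.A).subtype) (by
      rintro ⟨h, hh⟩
      rw [D.mem_Dlog hl]
      intro i
      change D.α i ∣ D.L (D.P h) i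
      rw [D.L_P h hh]
      exact ⟨_, rfl⟩)
  refine ⟨(LinearEquiv.ofBijective φ ⟨?_, ?_⟩).symm⟩
  · rw [injective_iff_map_eq_zero]
    rintro ⟨h, hh⟩ h0
    have h1 : D.P h = 0 := congrArg Subtype.val h0
    have h2 := D.L_P h hh
    rw [h1, L_eq, Matrix.mulVec_zero] at h2
    ext1
    ext1 i
    have := congrFun h2 i
    exact (mul_eq_zero.1 this.symm).resolve_left (D.α_ne_zero (by omega) i)
  · rintro ⟨θ, hθ⟩
    have hθ' := (D.mem_Dlog hl θ).1 hθ
    choose h hh using hθ'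
    have h1 : (fun i => D.α i * h i) = D.L θ := (funext hh).symm
    refine ⟨⟨h, ?_⟩, ?_⟩
    · rw [LinearMap.mem_ker, A_eq, h1, L_eq, Matrix.mulVec_mulVec, ← Matrix.map_mul, D.ca]
      simp
    · ext1
      change D.P h = θ
      rw [P_eq, h1, L_eq, Matrix.mulVec_mulVec, ← Matrix.map_mul, D.pa, Matrix.map_one _ (map_zero _) (map_one _), Matrix.one_mulVec]

lemma ext_equiv (hl : 3 ≤ l) : Nonempty (ExtGrp (MvPolynomial (Fin l) K)
    (ModuleCat.of _ (Module.Dual (MvPolynomial (Fin l) K) (Dlog K l (∏ i, D.α i))))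
    (ModuleCat.of _ (MvPolynomial (Fin l) K)) 1 ≃ₗ[MvPolynomial (Fin l) K]
      ((Fin m → MvPolynomial (Fin l) K) ⧸ LinearMap.range D.A)) := by
  obtain ⟨⟨N, hN⟩, -⟩ := D.upper (by omega)
  obtain ⟨e⟩ := D.equivD (by omega)
  have hx : ∀ i (v : Fin m → MvPolynomial (Fin l) K),
      ((X i : MvPolynomial (Fin l) K) ^ N) • v ∈ LinearMap.range D.A := fun i v =>
    hN (Submodule.smul_mem_smul (Ideal.pow_mem_pow (Ideal.subset_span (Set.mem_range_self i)) N) trivial)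
  exact ext_dual D.A (regTriple_X (i := (⟨0, by omega⟩ : Fin l)) (j := (⟨1, by omega⟩ : Fin l))
    (k := (⟨2, by omega⟩ : Fin l))
    (by simp) (by simp) (by simp) N) (hx _) (hx _) (hx _) e

end Arr
end RegPart
section LowerPart
open MvPolynomial
variable {K : Type} [Field K]

lemma count_deg (q d : ℕ) :
    {e : Fin (q + 1) →₀ ℕ | e.degree < d}.ncard = (q + d).choose (q + 1) := by
  classical
  induction d with
  | zero => simp
  | succ d ih =>
    have h1 : {e : Fin (q + 1) →₀ ℕ | e.degree < d + 1} = {e : Fin (q + 1) →₀ ℕ | e.degree < d} ∪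
        ((Finset.univ.finsuppAntidiag d : Finset (Fin (q + 1) →₀ ℕ)) : Set (Fin (q + 1) →₀ ℕ)) := by
      ext e
      simp only [Set.mem_ofPred_eq, Set.mem_union, Finset.mem_coe, Finset.mem_finsuppAntidiag,
        Finset.subset_univ, and_true, Finsupp.degree_eq_sum]
      change _ ↔ _ ∨ (∑ i, e i = d)
      omega
    rw [h1, Set.ncard_union_eq ?_ (Finsupp.finite_of_degree_lt d) (Finset.finite_toSet _), ih, Set.ncard_coe_finset, Finset.card_finsuppAntidiag_nat_eq_choose]
    · rw [Finset.card_univ, Fintype.card_fin, show q + 1 + d - 1 = q + d by omega,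
        show q + (d + 1) = (q + d) + 1 by ring, Nat.choose_succ_succ, add_comm,
        Nat.choose_symm_add]
    · rw [Set.disjoint_left]
      intro e he he'
      simp only [Set.mem_ofPred_eq, Finset.mem_coe, Finset.mem_finsuppAntidiag,
        Finset.subset_univ, and_true, Finsupp.degree_eq_sum] at he he'
      change ∑ i, e i = d at he'
      omega

/-- Polynomials with all monomials of degree less than `d`. -/
noncomputable def Ulow (K : Type) [Field K] (l d : ℕ) : Submodule K (MvPolynomial (Fin l) K) :=
  restrictSupport K {e | e.degree < d}

instance (l d : ℕ) : Module.Finite K (Ulow K l d) :=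
  have : Finite {e : Fin l →₀ ℕ | e.degree < d} := Finsupp.finite_of_degree_lt d
  Module.Finite.of_basis (basisRestrictSupport K _)

lemma finrank_Ulow (q d : ℕ) : Module.finrank K (Ulow K (q + 1) d) = (q + d).choose (q + 1) := by
  rw [Ulow, Module.finrank_eq_nat_card_basis (basisRestrictSupport K _), Nat.card_coe_set_eq, count_deg]

lemma low_decomp {l : ℕ} (d : ℕ) (p : MvPolynomial (Fin l) K) :
    ∃ q ∈ Ulow K l d, p - q ∈ restrictSupport K {e : Fin l →₀ ℕ | d ≤ e.degree} := by
  have : p ∈ Ulow K l d ⊔ restrictSupport K {e : Fin l →₀ ℕ | d ≤ e.degree} := by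
    rw [← support_sum_monomial_coeff p]
    refine sum_mem fun e _ => ?_
    by_cases h : e.degree < d
    · exact Submodule.mem_sup_left ((monomial_mem_restrictSupport K).2 (Or.inl h))
    · exact Submodule.mem_sup_right ((monomial_mem_restrictSupport K).2 (Or.inl (not_lt.1 h)))
  obtain ⟨q, hq, r, hr, rfl⟩ := Submodule.mem_sup.1 this
  exact ⟨q, hq, by simpa using hr⟩

lemma low_disj {l : ℕ} (d : ℕ) (p : MvPolynomial (Fin l) K) (h1 : p ∈ Ulow K l d)
    (h2 : p ∈ restrictSupport K {e : Fin l →₀ ℕ | d ≤ e.degree}) : p = 0 := by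
  rw [← support_eq_empty, Finset.eq_empty_iff_forall_notMem]
  intro e he
  have h3 := (mem_restrictSupport_iff _).1 h1 he
  have h4 := (mem_restrictSupport_iff _).1 h2 he
  simp only [Set.mem_ofPred_eq] at h3 h4
  omega

variable {l m n : ℕ} (D : Arr K l m n)

namespace Arr

lemma α_mem (i : Fin n) : D.α i ∈ restrictSupport K {e : Fin l →₀ ℕ | e.degree = 1} := by
  refine sum_mem fun k _ => ?_
  rw [C_mul_X_eq_monomial]
  exact (monomial_mem_restrictSupport K).2 (Or.inl (by simp))

lemma α_mul_low (i : Fin n) (d : ℕ) (p : MvPolynomial (Fin l) K) (h : p ∈ Ulow K l d) :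
    D.α i * p ∈ Ulow K l (d + 1) := by
  have h1 := Submodule.mul_mem_mul (D.α_mem i) h
  rw [Ulow, ← restrictSupport_add] at h1
  refine restrictSupport_mono _ ?_ h1
  rintro _ ⟨e, he, e', he', rfl⟩
  simp only [Set.mem_ofPred_eq, map_add] at *
  omega

lemma α_mul_high (i : Fin n) (d : ℕ) (p : MvPolynomial (Fin l) K)
    (h : p ∈ restrictSupport K {e : Fin l →₀ ℕ | d ≤ e.degree}) :
    D.α i * p ∈ restrictSupport K {e : Fin l →₀ ℕ | d + 1 ≤ e.degree} := by
  have h1 := Submodule.mul_mem_mul (D.α_mem i) h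
  rw [← restrictSupport_add] at h1
  refine restrictSupport_mono _ ?_ h1
  rintro _ ⟨e, he, e', he', rfl⟩
  simp only [Set.mem_ofPred_eq, map_add] at *
  omega

lemma A_low (d : ℕ) (h : Fin n → MvPolynomial (Fin l) K) (hh : ∀ i, h i ∈ Ulow K l d) (k : Fin m) :
    D.A h k ∈ Ulow K l (d + 1) := by
  rw [A_apply']
  refine sum_mem fun i _ => ?_
  rw [C_mul']
  exact Submodule.smul_mem _ _ (D.α_mul_low i d _ (hh i))

lemma A_high (d : ℕ) (h : Fin n → MvPolynomial (Fin l) K)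
    (hh : ∀ i, h i ∈ restrictSupport K {e : Fin l →₀ ℕ | d ≤ e.degree}) (k : Fin m) :
    D.A h k ∈ restrictSupport K {e : Fin l →₀ ℕ | d + 1 ≤ e.degree} := by
  rw [A_apply']
  refine sum_mem fun i _ => ?_
  rw [C_mul']
  exact Submodule.smul_mem _ _ (D.α_mul_high i d _ (hh i))

lemma A_one : D.A 1 = 0 := by
  rw [A_apply, ← D.sum_zero]
  simp

lemma exists_low (i₀ : Fin n) (d : ℕ) (v : Fin m → MvPolynomial (Fin l) K)
    (hv : ∀ k, v k ∈ Ulow K l (d + 1)) (hr : v ∈ LinearMap.range D.A) :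
    ∃ q : Fin n → MvPolynomial (Fin l) K, (∀ i, q i ∈ Ulow K l d) ∧ q i₀ = 0 ∧ D.A q = v := by
  obtain ⟨h, rfl⟩ := hr
  choose q hq hqr using fun i => low_decomp d ((h - h i₀ • (1 : Fin n → MvPolynomial (Fin l) K)) i)
  have hA : D.A (h - h i₀ • (1 : Fin n → MvPolynomial (Fin l) K)) = D.A h := by
    rw [map_sub, map_smul, A_one, smul_zero, sub_zero]
  refine ⟨q, hq, ?_, ?_⟩
  · apply low_disj d _ (hq i₀)
    have := hqr i₀
    simpa using this
  · rw [← hA] at hv ⊢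
    rw [eq_comm, ← sub_eq_zero, ← map_sub]
    ext1 k
    apply low_disj (d + 1)
    · rw [map_sub]
      exact Submodule.sub_mem _ (hv k) (D.A_low d q hq k)
    · exact D.A_high d _ hqr k

lemma lower (hl : 1 ≤ l) (hm : 1 ≤ m) : (((n - 1).choose l : ℕ) : ℕ∞) ≤
    Module.length K ((Fin m → MvPolynomial (Fin l) K) ⧸ LinearMap.range D.A) := by
  obtain ⟨q, rfl⟩ : ∃ q, l = q + 1 := ⟨l - 1, by omega⟩
  obtain ⟨d, rfl⟩ : ∃ d, m = d + 1 := ⟨m - 1, by omega⟩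
  have hn := D.hn
  let i₀ : Fin n := ⟨0, by omega⟩
  let ι : (Fin (d + 1) → Ulow K (q + 1) (d + 1)) →ₗ[K] (Fin (d + 1) → MvPolynomial (Fin (q + 1)) K) :=
    LinearMap.compLeft (Submodule.subtype _) _
  have hι : Function.Injective ι := by
    intro x y hxy
    ext1 k
    exact Subtype.ext (congrFun hxy k)
  let ψ := ((LinearMap.range D.A).mkQ.restrictScalars K).comp ι
  let Φ : ({i : Fin n // i ≠ i₀} → Ulow K (q + 1) d) →ₗ[K] (Fin (d + 1) → MvPolynomial (Fin (q + 1)) K) :=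
    (D.A.restrictScalars K).comp
      (LinearMap.pi fun i => if hi : i ≠ i₀ then
        (Ulow K (q + 1) d).subtype.comp (LinearMap.proj (⟨i, hi⟩ : {i : Fin n // i ≠ i₀})) else 0)
  have hker : (LinearMap.ker ψ).map ι ≤ LinearMap.range Φ := by
    rintro _ ⟨x, hx, rfl⟩
    have hx' : ι x ∈ LinearMap.range D.A := by
      have : (LinearMap.range D.A).mkQ (ι x) = 0 := hx
      rwa [Submodule.mkQ_apply, Submodule.Quotient.mk_eq_zero] at this
    obtain ⟨h, h1, h2, h3⟩ := D.exists_low i₀ d (ι x) (fun k => (x k).2) hx'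
    refine ⟨fun i => ⟨h i, h1 i⟩, ?_⟩
    rw [← h3]
    change D.A _ = D.A h
    congr 1
    ext1 i
    by_cases hi : i = i₀
    · simp [hi, h2]
    · simp [hi]
  have e1 : Module.finrank K (LinearMap.ker ψ) ≤ (q + d + 1) * (q + d).choose (q + 1) := by
    rw [LinearEquiv.finrank_eq (Submodule.equivMapOfInjective ι hι (LinearMap.ker ψ))]
    refine (Submodule.finrank_mono hker).trans ((LinearMap.finrank_range_le Φ).trans ?_)
    rw [Module.finrank_pi_fintype]
    simp only [finrank_Ulow, Finset.sum_const, Finset.card_univ, smul_eq_mul]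
    apply Nat.mul_le_mul_right
    rw [Fintype.card_subtype_compl, Fintype.card_fin, Fintype.card_subtype_eq]
    omega
  have e2 : Module.finrank K (LinearMap.range ψ) + Module.finrank K (LinearMap.ker ψ) =
      (d + 1) * (q + (d + 1)).choose (q + 1) := by
    rw [LinearMap.finrank_range_add_finrank_ker, Module.finrank_pi_fintype]
    simp [finrank_Ulow]
  have e3 := Nat.choose_mul_succ_eq (q + d) (q + 1)
  have e4 : (n - 1).choose (q + 1) ≤ Module.finrank K (LinearMap.range ψ) := by
    rw [show n - 1 = q + d + 1 by omega]
    rw [show q + (d + 1) = q + d + 1 by ring] at e2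
    rw [show q + d + 1 - (q + 1) = d by omega] at e3
    nlinarith
  calc _ ≤ ((Module.finrank K (LinearMap.range ψ) : ℕ) : ℕ∞) := by exact_mod_cast e4
    _ = Module.length K (LinearMap.range ψ) := (Module.length_eq_finrank _ _).symm
    _ ≤ _ := Module.length_le_of_injective (LinearMap.range ψ).subtype (Submodule.subtype_injective _)

lemma length_eq (hl : 1 ≤ l) (hm : 1 ≤ m) :
    Module.length (MvPolynomial (Fin l) K) ((Fin m → MvPolynomial (Fin l) K) ⧸ LinearMap.range D.A) =
      ((n - 1).choose l : ℕ) := by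
  obtain ⟨⟨k, hk⟩, hu⟩ := D.upper hl
  refine le_antisymm hu ?_
  rw [length_eq_of_nilp (K := K) _ h𝔪 k]
  · exact D.lower hl hm
  · have h1 := Submodule.map_smul'' (Ideal.span (Set.range (X : Fin l → MvPolynomial (Fin l) K)) ^ k)
      (⊤ : Submodule (MvPolynomial (Fin l) K) (Fin m → MvPolynomial (Fin l) K)) (LinearMap.range D.A).mkQ
    rw [Submodule.map_top (LinearMap.range D.A).mkQ, Submodule.range_mkQ] at h1
    rw [eq_bot_iff, ← h1, Submodule.map_le_iff_le_comap]
    intro x hx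
    have := hk hx
    rw [Submodule.mem_comap, Submodule.mem_bot, Submodule.mkQ_apply, Submodule.Quotient.mk_eq_zero]
    exact this

end Arr
end LowerPart
section FinalPart
open MvPolynomial
variable {K : Type} [Field K]

lemma exists_arr {l n : ℕ} (hn : l ≤ n) (α : Fin n → MvPolynomial (Fin l) K)
    (hlin : ∀ i, (α i).IsHomogeneous 1)
    (hgen : ∀ g : Fin l ↪ Fin n, LinearIndependent K (fun i => α (g i))) :
    ∃ D : Arr K l (n - l) n, ∀ i, D.α i = α i := by
  let a : Matrix (Fin n) (Fin l) K := Matrix.of fun i k => coeff (Finsupp.single k 1) (α i)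
  have hα : ∀ i, α i = ∑ k, C (a i k) * X k := by
    intro i
    ext d
    simp only [coeff_sum, coeff_C_mul, coeff_X, a, Matrix.of_apply]
    by_cases hd : d.degree = 1
    · obtain ⟨k, rfl⟩ := (Finsupp.sum_eq_one_iff d).1 hd
      rw [Finset.sum_eq_single k]
      · simp
      · intro j _ hj
        rw [if_neg, mul_zero]
        intro h
        exact hj ((Finsupp.single_left_inj one_ne_zero).1 h)
      · simp
    · rw [Finset.sum_eq_zero]
      · by_contra h
        have := hlin i h
        rw [Finsupp.degree_eq_weight_one (R := ℕ)] at hd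
        exact hd this
      · intro k _
        rw [if_neg, mul_zero]
        rintro rfl
        exact hd (by simp)
  have gen : ∀ (B : Finset (Fin n)) (r : Fin n → K), B.card = l → (∀ i, i ∉ B → r i = 0) →
      Matrix.vecMul r a = 0 → r = 0 := by
    intro B r hB hr h0
    let e : Fin l ≃ B := (Fintype.equivFinOfCardEq (by simpa using hB)).symm
    have h1 := Fintype.linearIndependent_iff.1 (hgen (e.toEmbedding.trans (Function.Embedding.subtype _)))
      (fun i => r (e i)) (by
        have h2 : ∑ i, r i • α i = 0 := by
          simp only [hα, Finset.smul_sum]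
          rw [Finset.sum_comm]
          refine Finset.sum_eq_zero fun k _ => ?_
          have := congrFun h0 k
          simp only [Matrix.vecMul, dotProduct, Pi.zero_apply] at this
          calc _ = C (∑ i, r i * a i k) * (X k : MvPolynomial (Fin l) K) := by
                rw [map_sum, Finset.sum_mul]
                refine Finset.sum_congr rfl fun i _ => ?_
                rw [C_mul, smul_eq_C_mul, mul_assoc]
            _ = 0 := by rw [this]; simp
        rw [← h2, ← Finset.sum_subset (Finset.subset_univ B), ← Finset.sum_attach B]
        · refine Finset.sum_equiv e ?_ ?_
          · simp
          · intro i _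
            rfl
        · intro i _ hi; simp [hr i hi])
    ext i
    by_cases hi : i ∈ B
    · simpa using h1 (e.symm ⟨i, hi⟩)
    · exact hr i hi
  have ainj : ∀ v, a.mulVec v = 0 → v = 0 := by
    intro v hv
    obtain ⟨B, -, hB⟩ : ∃ B ⊆ (Finset.univ : Finset (Fin n)), B.card = l :=
      Finset.exists_subset_card_eq (by rw [Finset.card_univ, Fintype.card_fin]; exact hn)
    let e : Fin l ≃ B := (Fintype.equivFinOfCardEq (by simpa using hB)).symm
    let M : Matrix (Fin l) (Fin l) K := Matrix.of fun i k => a (e i) k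
    obtain ⟨N, hN, -⟩ := exists_inv M (by
      intro y hy
      let r : Fin n → K := fun i => if h : i ∈ B then y (e.symm ⟨i, h⟩) else 0
      have hr : r = 0 := by
        apply gen B r hB
        · intro i hi; simp [r, hi]
        · ext k
          rw [← hy]
          simp only [Matrix.vecMul, dotProduct, M, Matrix.of_apply]
          rw [← Finset.sum_subset (Finset.subset_univ B), ← Finset.sum_attach]
          · refine (Finset.sum_equiv e ?_ ?_).symm
            · simp
            · intro i _
              simp [r]
          · intro i _ hi; simp [r, hi]
      ext i
      have := congrFun hr (e i)
      simpa [r] using this)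
    have hM : M.mulVec v = 0 := by
      ext i
      exact congrFun hv (e i)
    rw [← Matrix.one_mulVec v, ← hN, ← Matrix.mulVec_mulVec, hM, Matrix.mulVec_zero]
  obtain ⟨c, s, p, h1, h2, h3⟩ := exists_matrices (m := n - l) (by omega) a ainj
  have hpa : p * a = 1 := by
    have h4 : a * (p * a - (1 : Matrix (Fin l) (Fin l) K)) = 0 := by
      have := congrArg (fun M => M * a) h3
      simp only [Matrix.add_mul, Matrix.one_mul, Matrix.mul_assoc, h1, Matrix.mul_zero, add_zero] at this
      rw [Matrix.mul_sub, this, Matrix.mul_one, sub_self]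
    rw [← sub_eq_zero]
    ext i j
    have h5 := ainj (fun i => (p * a - (1 : Matrix (Fin l) (Fin l) K)) i j) (by
      ext t
      exact congrFun (congrFun h4 t) j)
    exact congrFun h5 i
  exact ⟨⟨a, c, s, p, h1, h2, hpa, h3, by omega, gen⟩, fun i => (hα i).symm⟩

end FinalPart

/-- Let `K` be a field of characteristic zero, `S = K[x_1, …, x_ℓ]` with `ℓ ≥ 3`, and let
`α_1, …, α_n` (`n > ℓ`) be nonzero linear forms, every `ℓ` of which are linearly independent
(a generic non-Boolean central arrangement).  Let `f = α_1 ⋯ α_n`.  Then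
`Ext^1_S(Ω^1(f), S)` has finite (composition) length equal to `C(n-1, ℓ)`, where
`Ω^1(f) = Hom_S(D(f), S)`. -/
theorem generic_ext_length (K : Type) [Field K] [CharZero K] (ℓ n : ℕ)
    (hl : 3 ≤ ℓ) (hn : ℓ < n)
    (α : Fin n → MvPolynomial (Fin ℓ) K)
    (hlin : ∀ i, α i ≠ 0 ∧ (α i).IsHomogeneous 1)
    (hgen : ∀ g : Fin ℓ ↪ Fin n, LinearIndependent K (fun i => α (g i)))
    (f : MvPolynomial (Fin ℓ) K) (hf : f = ∏ i, α i) :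
    ∃ s : CompositionSeries (Submodule (MvPolynomial (Fin ℓ) K)
      (ExtGrp (MvPolynomial (Fin ℓ) K)
        (ModuleCat.of (MvPolynomial (Fin ℓ) K)
          (Module.Dual (MvPolynomial (Fin ℓ) K) (Dlog K ℓ f)))
        (ModuleCat.of (MvPolynomial (Fin ℓ) K) (MvPolynomial (Fin ℓ) K)) 1)),
      s.head = ⊥ ∧ s.last = ⊤ ∧ s.length = (n - 1).choose ℓ := by
  obtain ⟨D, hD⟩ := exists_arr hn.le α (fun i => (hlin i).2) hgen
  have hf' : f = ∏ i, D.α i := by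
    rw [hf]
    exact Finset.prod_congr rfl fun i _ => (hD i).symm
  subst hf'
  obtain ⟨e⟩ := D.ext_equiv hl
  have hlen := e.length_eq
  rw [D.length_eq (by omega) (by omega)] at hlen
  have hfin := Module.length_ne_top_iff.1 (hlen ▸ ENat.natCast_ne_top _)
  obtain ⟨s, hs1, hs2⟩ := isFiniteLength_iff_exists_compositionSeries.1 hfin
  refine ⟨s, hs1, hs2, ?_⟩
  have h3 := Module.length_compositionSeries s hs1 hs2
  rw [hlen] at h3
  exact_mod_cast h3
end
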